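/- Let K ⊂ ℝⁿ be a convex body of class C²₊ and let α > 0 be such that all principal curvatures of ∂K are greater than or equal to α at every point. Then the first nonzero eigenvalue λ(∂K) of the Laplace–Beltrami operator on ∂K satisfies λ(∂K) ≥ (n-1) α². -/

import Mathlib

open MeasureTheory Metric
open scoped RealInnerProductSpace ENNReal

noncomputable section

/-- Euclidean `n`-space. -/
abbrev E (n : ℕ) : Type := EuclideanSpace ℝ (Fin n)

/-- Orthogonal projection onto the hyperplane orthogonal to the unit vector `u`
(the tangent space at a boundary point with outer unit normal `u`). -/
noncomputable def tproj {n : ℕ} (u : E n) : E n →L[ℝ] E n :=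
  ContinuousLinearMap.id ℝ (E n) - (innerSL ℝ u).smulRight u

open scoped Pointwise in
theorem volume_add_volume_le_two_mul_of_isCompact {A B W : Set ℝ} (hA : IsCompact A)
    (hB : IsCompact B) (hA0 : A.Nonempty) (hB0 : B.Nonempty)
    (h : ∀ a ∈ A, ∀ b ∈ B, (a + b) / 2 ∈ W) :
    volume A + volume B ≤ 2 * volume W := by
  obtain ⟨a, ha⟩ := hA.exists_isGreatest hA0
  obtain ⟨b, hb⟩ := hB.exists_isLeast hB0
  have hsub : (2 : ℝ)⁻¹ • ((· + b) '' A) ∪ (2 : ℝ)⁻¹ • ((a + ·) '' B) ⊆ W := by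
    rintro _ (⟨_, ⟨x, hx, rfl⟩, rfl⟩ | ⟨_, ⟨x, hx, rfl⟩, rfl⟩)
    · convert! h x hx b hb.1 using 1
      simp; ring
    · convert! h a ha.1 x hx using 1
      simp; ring
  have hmeas : MeasurableSet ((2 : ℝ)⁻¹ • ((a + ·) '' B)) :=
    ((hB.image (by fun_prop)).smul _).measurableSet
  have hdisj : AEDisjoint volume ((2 : ℝ)⁻¹ • ((· + b) '' A)) ((2 : ℝ)⁻¹ • ((a + ·) '' B)) := by
    refine measure_mono_null (t := {(a + b) / 2}) ?_ (by simp)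
    rintro _ ⟨⟨_, ⟨x, hx, rfl⟩, rfl⟩, ⟨_, ⟨y, hy, rfl⟩, hxy⟩⟩
    have h1 := ha.2 hx
    have h2 := hb.2 hy
    simp only [smul_eq_mul] at hxy ⊢
    rw [Set.mem_singleton_iff]
    linarith
  have h2 : volume ((2 : ℝ)⁻¹ • ((· + b) '' A)) + volume ((2 : ℝ)⁻¹ • ((a + ·) '' B)) ≤
      volume W := by
    rw [← measure_union₀ hmeas.nullMeasurableSet hdisj]
    exact measure_mono hsub
  rw [Measure.addHaar_smul, Measure.addHaar_smul] at h2
  simp only [Module.finrank_self, pow_one, Set.image_add_right, measure_preimage_add_right,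
    Set.image_add_left, measure_preimage_add] at h2
  rw [← mul_add] at h2
  calc volume A + volume B = 2 * (ENNReal.ofReal |2⁻¹| * (volume A + volume B)) := by
        rw [← mul_assoc, abs_of_pos (by norm_num), ENNReal.ofReal_inv_of_pos (by norm_num),
          ENNReal.ofReal_ofNat, ENNReal.mul_inv_cancel (by simp) (by simp), one_mul]
    _ ≤ _ := by gcongr

theorem volume_add_volume_le_two_mul {A B W : Set ℝ} (hA : MeasurableSet A)
    (hB : MeasurableSet B) (hA0 : A.Nonempty) (hB0 : B.Nonempty)
    (h : ∀ a ∈ A, ∀ b ∈ B, (a + b) / 2 ∈ W) :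
    volume A + volume B ≤ 2 * volume W := by
  obtain ⟨a, ha⟩ := hA0
  obtain ⟨b, hb⟩ := hB0
  rw [hA.measure_eq_iSup_isCompact, hB.measure_eq_iSup_isCompact]
  simp only [iSup_and']
  refine ENNReal.biSup_add_biSup_le' ⟨∅, by simp⟩ ⟨∅, by simp⟩ ?_
  rintro K ⟨hK, hKc⟩ L ⟨hL, hLc⟩
  calc volume K + volume L ≤ volume (insert a K) + volume (insert b L) := by
        gcongr <;> exact Set.subset_insert _ _
    _ ≤ _ := volume_add_volume_le_two_mul_of_isCompact (hKc.insert a) (hLc.insert b)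
        (Set.insert_nonempty _ _) (Set.insert_nonempty _ _)
        fun x hx y hy => h x (Set.insert_subset ha hK hx) y (Set.insert_subset hb hL hy)

/-- The one-dimensional Prékopa–Leindler inequality for functions with values in `[0, 1]` whose
supremum is `1`, in arithmetic form. -/
theorem lintegral_add_lintegral_le_two_mul {f g h : ℝ → ℝ} (hf : Measurable f)
    (hg : Measurable g) (hh : Measurable h) (hf0 : ∀ x, 0 ≤ f x) (hg0 : ∀ x, 0 ≤ g x)
    (hh0 : ∀ x, 0 ≤ h x) (hf1 : ∀ r < 1, ∃ x, r < f x) (hg1 : ∀ r < 1, ∃ x, r < g x)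
    (hf1' : ∀ x, f x ≤ 1) (hg1' : ∀ x, g x ≤ 1)
    (H : ∀ x y, f x * g y ≤ h ((x + y) / 2) ^ 2) :
    (∫⁻ x, ENNReal.ofReal (f x)) + ∫⁻ x, ENNReal.ofReal (g x) ≤
      2 * ∫⁻ x, ENNReal.ofReal (h x) := by
  have hmeas : Measurable fun r => volume {x | r < f x} :=
    Antitone.measurable fun r s hrs => measure_mono fun x (hx : s < f x) => hrs.trans_lt hx
  rw [lintegral_eq_lintegral_meas_lt _ (.of_forall hf0) hf.aemeasurable,
    lintegral_eq_lintegral_meas_lt _ (.of_forall hg0) hg.aemeasurable,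
    lintegral_eq_lintegral_meas_lt _ (.of_forall hh0) hh.aemeasurable,
    ← lintegral_add_left hmeas, ← lintegral_const_mul' _ _ (by simp)]
  refine setLIntegral_mono' measurableSet_Ioi fun r hr => ?_
  rcases lt_or_ge r 1 with hr1 | hr1
  · refine volume_add_volume_le_two_mul (measurableSet_lt measurable_const hf)
      (measurableSet_lt measurable_const hg) (hf1 r hr1) (hg1 r hr1) fun x hx y hy => ?_
    have hr0 : 0 < r := hr
    have h1 : r * r < f x * g y := mul_lt_mul'' hx hy hr0.le hr0.le
    have h2 := H x y
    exact lt_of_pow_lt_pow_left₀ 2 (hh0 _) (by nlinarith)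
  · have h1 : {x | r < f x} = ∅ := by
      ext x; simpa using (hf1' x).trans hr1
    have h2 : {x | r < g x} = ∅ := by
      ext x; simpa using (hg1' x).trans hr1
    simp [h1, h2]

theorem ENNReal.four_mul_mul_le_add_sq (p q : ℝ≥0∞) : 4 * (p * q) ≤ (p + q) ^ 2 := by
  rcases eq_or_ne p ⊤ with rfl | hp
  · simp
  rcases eq_or_ne q ⊤ with rfl | hq
  · simp
  lift p to NNReal using hp
  lift q to NNReal using hq
  norm_cast
  rw [← NNReal.coe_le_coe]
  push_cast
  nlinarith [sq_nonneg ((p : ℝ) - q)]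

theorem exists_lt_toReal_div_of_eq_iSup {u : ℝ → ℝ≥0∞} {a r : ℝ} (hapos : 0 < a)
    (ha : a = (⨆ x, u x).toReal) (hu : ∀ x, u x ≤ ENNReal.ofReal a) (hr : r < 1) :
    ∃ x, r < (u x).toReal / a := by
  by_contra! hcon
  have h1 : ⨆ x, u x ≤ ENNReal.ofReal (r * a) := iSup_le fun x => by
    rw [← ENNReal.ofReal_toReal (ne_top_of_le_ne_top (by simp) (hu x))]
    exact ENNReal.ofReal_le_ofReal ((div_le_iff₀ hapos).1 (hcon x))
  have h2 := ENNReal.toReal_mono (by simp) h1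
  rw [← ha, ENNReal.toReal_ofReal'] at h2
  rcases le_max_iff.1 h2 with h3 | h3 <;> nlinarith

theorem prekopa_leindler_real_of_bounded {f g h : ℝ → ℝ≥0∞} (hf : Measurable f)
    (hg : Measurable g) (hh : Measurable h) (hfb : ⨆ x, f x ≠ ⊤) (hgb : ⨆ x, g x ≠ ⊤)
    (H : ∀ x y, f x * g y ≤ h ((x + y) / 2) ^ 2) :
    (∫⁻ x, f x) * ∫⁻ x, g x ≤ (∫⁻ x, h x) ^ 2 := by
  rcases eq_or_ne (⨆ x, f x) 0 with ha0 | ha0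
  · have : ∀ x, f x = 0 := by simpa using ha0
    simp [this]
  rcases eq_or_ne (⨆ x, g x) 0 with hb0 | hb0
  · have : ∀ x, g x = 0 := by simpa using hb0
    simp [this]
  obtain ⟨a, ha⟩ : ∃ a : ℝ, a = (⨆ x, f x).toReal := ⟨_, rfl⟩
  obtain ⟨b, hb⟩ : ∃ b : ℝ, b = (⨆ x, g x).toReal := ⟨_, rfl⟩
  have hapos : 0 < a := ha ▸ ENNReal.toReal_pos ha0 hfb
  have hbpos : 0 < b := hb ▸ ENNReal.toReal_pos hb0 hgb
  have hfle : ∀ x, f x ≤ ENNReal.ofReal a := fun x => by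
    rw [ha, ENNReal.ofReal_toReal hfb]; exact le_iSup f x
  have hgle : ∀ x, g x ≤ ENNReal.ofReal b := fun x => by
    rw [hb, ENNReal.ofReal_toReal hgb]; exact le_iSup g x
  have hc : 0 < √(a * b) := Real.sqrt_pos.2 (by positivity)
  have hcsq : √(a * b) ^ 2 = a * b := Real.sq_sqrt (by positivity)
  have hf' : ∀ x, f x = ENNReal.ofReal a * ENNReal.ofReal ((f x).toReal / a) := fun x => by
    rw [← ENNReal.ofReal_mul hapos.le, mul_div_cancel₀ _ hapos.ne',
      ENNReal.ofReal_toReal (ne_top_of_le_ne_top (by simp) (hfle x))]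
  have hg' : ∀ x, g x = ENNReal.ofReal b * ENNReal.ofReal ((g x).toReal / b) := fun x => by
    rw [← ENNReal.ofReal_mul hbpos.le, mul_div_cancel₀ _ hbpos.ne',
      ENNReal.ofReal_toReal (ne_top_of_le_ne_top (by simp) (hgle x))]
  have hmin : ∀ x, min (h x) (ENNReal.ofReal √(a * b)) ≠ ⊤ := fun x =>
    ne_top_of_le_ne_top (by simp) (min_le_right _ _)
  have hh' : ∀ x, ENNReal.ofReal √(a * b) *
      ENNReal.ofReal ((min (h x) (ENNReal.ofReal √(a * b))).toReal / √(a * b)) ≤ h x := fun x => by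
    rw [← ENNReal.ofReal_mul hc.le, mul_div_cancel₀ _ hc.ne', ENNReal.ofReal_toReal (hmin x)]
    exact min_le_left _ _
  have key := lintegral_add_lintegral_le_two_mul (f := fun x => (f x).toReal / a)
    (g := fun x => (g x).toReal / b)
    (h := fun x => (min (h x) (ENNReal.ofReal √(a * b))).toReal / √(a * b))
    (hf.ennreal_toReal.div_const _) (hg.ennreal_toReal.div_const _)
    ((hh.min measurable_const).ennreal_toReal.div_const _)
    (fun x => by positivity) (fun x => by positivity) (fun x => by positivity)
    (fun r hr => exists_lt_toReal_div_of_eq_iSup hapos ha hfle hr)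
    (fun r hr => exists_lt_toReal_div_of_eq_iSup hbpos hb hgle hr)
    (fun x => (div_le_one hapos).2 (ENNReal.toReal_le_of_le_ofReal hapos.le (hfle x)))
    (fun x => (div_le_one hbpos).2 (ENNReal.toReal_le_of_le_ofReal hbpos.le (hgle x)))
    (fun x y => by
      rw [div_mul_div_comm, div_pow, hcsq]
      gcongr
      rw [← ENNReal.toReal_mul, ← ENNReal.toReal_pow]
      refine ENNReal.toReal_mono (ENNReal.pow_ne_top (hmin _)) ?_
      rcases min_choice (h ((x + y) / 2)) (ENNReal.ofReal √(a * b)) with h1 | h1 <;> rw [h1]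
      · exact H x y
      · rw [← ENNReal.ofReal_pow hc.le, hcsq, ENNReal.ofReal_mul hapos.le]
        exact mul_le_mul' (hfle x) (hgle y))
  calc (∫⁻ x, f x) * ∫⁻ x, g x
      = ENNReal.ofReal (a * b) * ((∫⁻ x, ENNReal.ofReal ((f x).toReal / a)) *
        ∫⁻ x, ENNReal.ofReal ((g x).toReal / b)) := by
        rw [lintegral_congr hf', lintegral_congr hg', lintegral_const_mul' _ _ (by simp),
          lintegral_const_mul' _ _ (by simp), ENNReal.ofReal_mul hapos.le]
        ring
    _ ≤ ENNReal.ofReal (a * b) * (∫⁻ x, ENNReal.ofReal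
        ((min (h x) (ENNReal.ofReal √(a * b))).toReal / √(a * b))) ^ 2 := by
        gcongr
        have h1 := (ENNReal.four_mul_mul_le_add_sq _ _).trans (pow_le_pow_left' key 2)
        rw [mul_pow] at h1
        norm_num at h1
        rwa [ENNReal.mul_le_mul_iff_right (by simp) (by simp)] at h1
    _ = (∫⁻ x, ENNReal.ofReal √(a * b) * ENNReal.ofReal
        ((min (h x) (ENNReal.ofReal √(a * b))).toReal / √(a * b))) ^ 2 := by
        rw [lintegral_const_mul' _ _ (by simp), mul_pow, ← ENNReal.ofReal_pow hc.le, hcsq]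
    _ ≤ _ := by
        gcongr with x
        exact hh' x

theorem prekopa_leindler_real {f g h : ℝ → ℝ≥0∞} (hf : Measurable f)
    (hg : Measurable g) (hh : Measurable h)
    (H : ∀ x y, f x * g y ≤ h ((x + y) / 2) ^ 2) :
    (∫⁻ x, f x) * ∫⁻ x, g x ≤ (∫⁻ x, h x) ^ 2 := by
  have htr : ∀ {u : ℝ → ℝ≥0∞}, Measurable u →
      ∫⁻ x, u x = ⨆ N : ℕ, ∫⁻ x, min (u x) N := by
    intro u hu
    rw [← lintegral_iSup (fun N => hu.min measurable_const)
      fun M N hMN x => min_le_min_left _ (by exact_mod_cast hMN)]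
    congr 1 with x
    rw [← inf_iSup_eq, ENNReal.iSup_natCast]
    simp
  have hb : ∀ (u : ℝ → ℝ≥0∞) (N : ℕ), ⨆ x, min (u x) N ≠ ⊤ := fun u N =>
    ne_top_of_le_ne_top (ENNReal.natCast_ne_top N) (iSup_le fun x => min_le_right _ _)
  rw [htr hf, htr hg, ENNReal.iSup_mul]
  refine iSup_le fun N => ?_
  rw [ENNReal.mul_iSup]
  refine iSup_le fun M => ?_
  exact prekopa_leindler_real_of_bounded (hf.min measurable_const) (hg.min measurable_const) hh
    (hb f N) (hb g M) fun x y =>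
      (mul_le_mul' (min_le_left _ _) (min_le_left _ _)).trans (H x y)

theorem prekopa_leindler (d : ℕ) {f g h : (Fin d → ℝ) → ℝ≥0∞} (hf : Measurable f)
    (hg : Measurable g) (hh : Measurable h)
    (H : ∀ x y, f x * g y ≤ h ((2 : ℝ)⁻¹ • (x + y)) ^ 2) :
    (∫⁻ x, f x) * ∫⁻ x, g x ≤ (∫⁻ x, h x) ^ 2 := by
  induction d with
  | zero =>
    rw [lintegral_unique, lintegral_unique, lintegral_unique]
    have h0 : ∀ a : Fin 0 → ℝ, f a * g a ≤ h a ^ 2 := fun a => by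
      simpa only [Subsingleton.elim ((2 : ℝ)⁻¹ • (a + a)) a] using H a a
    have h1 : (volume : Measure (Fin 0 → ℝ)) Set.univ = 1 := by simp [volume_pi]
    rw [h1, mul_one, mul_one, mul_one]
    exact h0 _
  | succ d ih =>
    have hcons : Measurable fun p : ℝ × (Fin d → ℝ) => (Fin.cons p.1 p.2 : Fin (d + 1) → ℝ) :=
      measurable_pi_iff.2 <| Fin.cases measurable_fst
        fun j => (measurable_pi_apply j).comp measurable_snd
    have key : ∀ {u : (Fin (d + 1) → ℝ) → ℝ≥0∞}, Measurable u →
        ∫⁻ x, u x = ∫⁻ s : ℝ, ∫⁻ y : Fin d → ℝ, u (Fin.cons s y) := by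
      intro u hu
      rw [← (volume_preserving_piFinSuccAbove (fun _ : Fin (d + 1) => ℝ) 0).symm.lintegral_comp hu,
        Measure.volume_eq_prod]
      refine (lintegral_congr fun a => ?_).trans
        (lintegral_prod (fun p => u (Fin.cons p.1 p.2)) (hu.comp hcons).aemeasurable)
      simp [Fin.consEquiv]
    rw [key hf, key hg, key hh]
    have hm : ∀ {u : (Fin (d + 1) → ℝ) → ℝ≥0∞}, Measurable u →
        Measurable fun s : ℝ => ∫⁻ y : Fin d → ℝ, u (Fin.cons s y) := fun hu =>
      (hu.comp hcons).lintegral_prod_right'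
    refine prekopa_leindler_real (hm hf) (hm hg) (hm hh) fun s t => ?_
    refine ih (hf.comp (hcons.comp measurable_prodMk_left))
      (hg.comp (hcons.comp measurable_prodMk_left))
      (hh.comp (hcons.comp measurable_prodMk_left)) fun x y => ?_
    refine (H (Fin.cons s x) (Fin.cons t y)).trans_eq ?_
    congr 2
    ext i
    refine Fin.cases ?_ (fun j => ?_) i
    · simp; ring
    · simp; ring

/-- The multiplicative Brunn–Minkowski inequality. -/
theorem volume_mul_volume_le_sq_of_midpoint_mem {d : ℕ} {A B W : Set (EuclideanSpace ℝ (Fin d))}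
    (hA : MeasurableSet A) (hB : MeasurableSet B) (hW : MeasurableSet W)
    (h : ∀ a ∈ A, ∀ b ∈ B, (2 : ℝ)⁻¹ • (a + b) ∈ W) :
    volume A * volume B ≤ volume W ^ 2 := by
  have hpre : ∀ {S : Set (EuclideanSpace ℝ (Fin d))}, MeasurableSet S →
      volume S = ∫⁻ x : Fin d → ℝ, S.indicator 1 (WithLp.toLp 2 x) :=
      fun hS => by
    rw [← lintegral_indicator_one hS,
      (PiLp.volume_preserving_toLp (Fin d)).lintegral_comp (measurable_one.indicator hS)]
  have hmeas : ∀ {S : Set (EuclideanSpace ℝ (Fin d))}, MeasurableSet S →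
      Measurable fun x : Fin d → ℝ => S.indicator (fun _ => (1 : ℝ≥0∞)) (WithLp.toLp 2 x) :=
      fun hS =>
    (measurable_const.indicator hS).comp (PiLp.volume_preserving_toLp (Fin d)).measurable
  rw [hpre hA, hpre hB, hpre hW]
  refine prekopa_leindler d (hmeas hA) (hmeas hB) (hmeas hW) fun x y => ?_
  by_cases hx : WithLp.toLp 2 x ∈ A
  · by_cases hy : WithLp.toLp 2 y ∈ B
    · have := h _ hx _ hy
      rw [← WithLp.toLp_add, ← WithLp.toLp_smul] at this
      rw [Set.indicator_of_mem hx, Set.indicator_of_mem hy, Set.indicator_of_mem this]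
      simp
    · simp [hy]
  · simp [hx]

section ConvexGeometry

variable {V : Type*} [NormedAddCommGroup V] [InnerProductSpace ℝ V]

theorem exists_uniform_fderiv_approx {W : Type*} [NormedAddCommGroup W] [NormedSpace ℝ W]
    {S U : Set V} {ν : V → W} (hS : IsCompact S)
    (hU : IsOpen U) (hSU : S ⊆ U) (hν : ContDiffOn ℝ 1 ν U) {ε : ℝ} (hε : 0 < ε) :
    ∃ δ > 0, ∀ z ∈ S, ∀ y, ‖y - z‖ ≤ δ → ‖ν y - ν z - fderiv ℝ ν z (y - z)‖ ≤ ε * ‖y - z‖ := by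
  refine hS.induction_on (p := fun T => ∃ δ > 0, ∀ z ∈ T, ∀ y, ‖y - z‖ ≤ δ →
      ‖ν y - ν z - fderiv ℝ ν z (y - z)‖ ≤ ε * ‖y - z‖) ⟨1, one_pos, by simp⟩ ?_ ?_ ?_
  · rintro s t hst ⟨δ, hδ, h⟩
    exact ⟨δ, hδ, fun z hz => h z (hst hz)⟩
  · rintro s t ⟨δ, hδ, h⟩ ⟨δ', hδ', h'⟩
    refine ⟨min δ δ', lt_min hδ hδ', ?_⟩
    rintro z (hz | hz) y hy
    · exact h z hz y (hy.trans (min_le_left _ _))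
    · exact h' z hz y (hy.trans (min_le_right _ _))
  · intro z₀ hz₀
    have hc : ContDiffAt ℝ 1 ν z₀ := hν.contDiffAt (hU.mem_nhds (hSU hz₀))
    have hs := (hc.hasStrictFDerivAt one_ne_zero).isLittleO.def (half_pos hε)
    have hf : ContinuousAt (fderiv ℝ ν) z₀ :=
      (hν.continuousOn_fderiv_of_isOpen hU le_rfl).continuousAt (hU.mem_nhds (hSU hz₀))
    obtain ⟨r, hr, hrs⟩ := Metric.eventually_nhds_iff_ball.1 hs
    obtain ⟨r', hr', hrf⟩ := Metric.eventually_nhds_iff_ball.1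
      (Metric.tendsto_nhds.1 hf (ε / 2) (half_pos hε))
    refine ⟨ball z₀ (min r r' / 2), mem_nhdsWithin_of_mem_nhds (ball_mem_nhds _ (by positivity)),
      min r r' / 3, by positivity, fun z hz y hy => ?_⟩
    have hm : 0 < min r r' := lt_min hr hr'
    rw [mem_ball] at hz
    have hyz : dist y z₀ < min r r' := by
      have := dist_triangle y z z₀
      rw [dist_eq_norm y z] at this
      linarith
    have h1 := hrs (y, z) (by
      rw [← ball_prod_same, Set.mem_prod, mem_ball, mem_ball]
      exact ⟨hyz.trans_le (min_le_left _ _), by linarith [min_le_left r r']⟩)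
    have h2 := (hrf z (by rw [mem_ball]; linarith [min_le_right r r'])).le
    rw [dist_eq_norm] at h2
    have h3 := (fderiv ℝ ν z - fderiv ℝ ν z₀).le_of_opNorm_le h2 (y - z)
    rw [sub_apply] at h3
    simp only at h1
    calc ‖ν y - ν z - fderiv ℝ ν z (y - z)‖
        = ‖(ν y - ν z - fderiv ℝ ν z₀ (y - z)) -
          (fderiv ℝ ν z (y - z) - fderiv ℝ ν z₀ (y - z))‖ := by congr 1; abel
      _ ≤ ε / 2 * ‖y - z‖ + ε / 2 * ‖y - z‖ := (norm_sub_le _ _).trans (add_le_add h1 h3)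
      _ = _ := by ring

/-- A compact convex set with a Lipschitz field of outer unit normals on its boundary. -/
structure IsSmoothConvexBody (K : Set V) (ν : V → V) (L : ℝ) : Prop where
  convex : Convex ℝ K
  isCompact : IsCompact K
  nonempty_interior : (interior K).Nonempty
  norm_eq_one : ∀ x ∈ frontier K, ‖ν x‖ = 1
  inner_nonpos : ∀ x ∈ frontier K, ∀ y ∈ K, ⟪y - x, ν x⟫ ≤ 0
  L_nonneg : 0 ≤ L
  lipschitz : ∀ x ∈ frontier K, ∀ y ∈ frontier K, ‖ν x - ν y‖ ≤ L * ‖x - y‖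

theorem exists_bound_norm_fderiv {S U : Set V} {ν : V → V} (hS : IsCompact S)
    (hU : IsOpen U) (hSU : S ⊆ U) (hν : ContDiffOn ℝ 1 ν U) :
    ∃ M > 0, ∀ z ∈ S, ‖fderiv ℝ ν z‖ ≤ M := by
  obtain ⟨M, hM⟩ := hS.exists_bound_of_continuousOn
    ((hν.continuousOn_fderiv_of_isOpen hU le_rfl).mono hSU)
  exact ⟨max M 1, by positivity, fun z hz => (hM z hz).trans (le_max_left _ _)⟩

theorem IsCompact.isCompact_frontier {X : Type*} [TopologicalSpace X] [T2Space X] {K : Set X}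
    (hK : IsCompact K) : IsCompact (frontier K) :=
  hK.of_isClosed_subset isClosed_frontier hK.isClosed.frontier_subset

theorem IsSmoothConvexBody.of_contDiffOn {K U : Set V} {ν : V → V} (hKconv : Convex ℝ K)
    (hKcomp : IsCompact K) (hKint : (interior K).Nonempty) (hU : IsOpen U)
    (hKU : frontier K ⊆ U) (hν : ContDiffOn ℝ 1 ν U) (hν1 : ∀ x ∈ frontier K, ‖ν x‖ = 1)
    (hνo : ∀ x ∈ frontier K, ∀ y ∈ K, ⟪y - x, ν x⟫ ≤ 0) :
    ∃ L, IsSmoothConvexBody K ν L := by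
  have hS := hKcomp.isCompact_frontier
  obtain ⟨M, hM0, hM⟩ := exists_bound_norm_fderiv hS hU hKU hν
  obtain ⟨δ, hδ, h⟩ := exists_uniform_fderiv_approx hS hU hKU hν one_pos
  refine ⟨max (M + 1) (2 / δ), hKconv, hKcomp, hKint, hν1, hνo, by positivity, fun x hx y hy => ?_⟩
  rcases le_or_gt ‖x - y‖ δ with hxy | hxy
  · have h1 := h y hy x hxy
    have h2 := (fderiv ℝ ν y).le_of_opNorm_le (hM y hy) (x - y)
    calc ‖ν x - ν y‖ = ‖(ν x - ν y - fderiv ℝ ν y (x - y)) + fderiv ℝ ν y (x - y)‖ := by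
          congr 1; abel
      _ ≤ 1 * ‖x - y‖ + M * ‖x - y‖ := (norm_add_le _ _).trans (add_le_add h1 h2)
      _ = (M + 1) * ‖x - y‖ := by ring
      _ ≤ _ := by gcongr; exact le_max_left _ _
  · calc ‖ν x - ν y‖ ≤ 1 + 1 := (norm_sub_le _ _).trans (by rw [hν1 x hx, hν1 y hy])
      _ = 2 / δ * δ := by field_simp; norm_num
      _ ≤ 2 / δ * ‖x - y‖ := by gcongr
      _ ≤ _ := by gcongr; exact le_max_right _ _

theorem half_mul_sq_le_sub_of_increment {f : ℝ → ℝ} {c r : ℝ} (hr : 0 ≤ r)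
    (h : ∀ p p', 0 ≤ p → p ≤ p' → p' ≤ r → c * p * (p' - p) ≤ f p' - f p) :
    c / 2 * r ^ 2 ≤ f r - f 0 := by
  have key : ∀ N : ℕ, 0 < N → c / 2 * r ^ 2 - c / 2 * r ^ 2 / N ≤ f r - f 0 := by
    intro N hN
    have hN' : (0 : ℝ) < N := by exact_mod_cast hN
    have ind : ∀ j : ℕ, j ≤ N →
        c / 2 * (j * r / N) ^ 2 - c / 2 * (r / N) ^ 2 * j ≤ f (j * r / N) - f 0 := by
      intro j
      induction j with
      | zero => simp
      | succ j ih =>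
        intro hj
        have hj' : (j : ℝ) + 1 ≤ N := by exact_mod_cast hj
        have h1 := ih (by omega)
        have h2 := h (j * r / N) ((j + 1 : ℕ) * r / N) (by positivity)
          (by gcongr; simp) (by rw [div_le_iff₀ hN', mul_comm r]; push_cast; gcongr)
        push_cast at h2 ⊢
        have h3 : c / 2 * (((j : ℝ) + 1) * r / N) ^ 2 - c / 2 * (r / N) ^ 2 * (j + 1) =
          c / 2 * (j * r / N) ^ 2 - c / 2 * (r / N) ^ 2 * j +
            c * (j * r / N) * ((j + 1) * r / N - j * r / N) := by ring
        linarith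
    have := ind N le_rfl
    rw [mul_div_cancel_left₀ _ hN'.ne'] at this
    refine le_trans (le_of_eq ?_) this
    field_simp
  have hlim : Filter.Tendsto (fun N : ℕ => c / 2 * r ^ 2 - c / 2 * r ^ 2 / N) Filter.atTop
      (nhds (c / 2 * r ^ 2 - 0)) :=
    tendsto_const_nhds.sub (tendsto_const_div_atTop_nhds_zero_nat _)
  rw [sub_zero] at hlim
  exact le_of_tendsto hlim (Filter.eventually_atTop.2 ⟨1, fun N hN => key N hN⟩)

end ConvexGeometry

section UniformConvexity

variable {V : Type*} [NormedAddCommGroup V] [InnerProductSpace ℝ V]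

theorem IsCompact.exists_sub_smul_mem_frontier {K : Set V} (hK : IsCompact K) {w v : V}
    (hv : ‖v‖ = 1) {D : ℝ} (hD : w - D • v ∈ K) : ∃ q ≤ D, w - q • v ∈ frontier K := by
  have hc : IsCompact ((fun q : ℝ => w - q • v) ⁻¹' K) := by
    refine Metric.isCompact_of_isClosed_isBounded (hK.isClosed.preimage (by fun_prop)) ?_
    obtain ⟨R, hR⟩ := hK.isBounded.exists_norm_le
    refine Metric.isBounded_iff_subset_closedBall (0 : ℝ) |>.2 ⟨R + ‖w‖, fun q hq => ?_⟩
    rw [mem_closedBall_zero_iff]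
    have h1 := hR _ hq
    have h2 := norm_sub_norm_le (q • v) w
    rw [norm_smul, hv, mul_one, norm_sub_rev] at h2
    linarith
  obtain ⟨q, hq, hqmin⟩ := hc.exists_isLeast ⟨D, hD⟩
  refine ⟨q, hqmin hD, subset_closure hq, fun hintegral => ?_⟩
  have hcont : Continuous fun q : ℝ => w - q • v := by fun_prop
  have hmem : (fun q : ℝ => w - q • v) ⁻¹' interior K ∈ nhds q :=
    hcont.continuousAt.preimage_mem_nhds (isOpen_interior.mem_nhds hintegral)
  obtain ⟨ε, hε, hball⟩ := Metric.mem_nhds_iff.1 hmem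
  have h1 : q - ε / 2 ∈ ball q ε := by
    rw [mem_ball, Real.dist_eq, abs_lt]; constructor <;> linarith
  have h2 := hqmin (show q - ε / 2 ∈ (fun q : ℝ => w - q • v) ⁻¹' K from
    interior_subset (s := K) (hball h1))
  linarith

theorem inner_eq_one_sub_of_norm_eq_one {a b : V} (ha : ‖a‖ = 1) (hb : ‖b‖ = 1) :
    ⟪a, b⟫ = 1 - ‖a - b‖ ^ 2 / 2 := by
  have := norm_sub_sq_real a b
  rw [ha, hb] at this
  linarith

set_option maxHeartbeats 400000 in
theorem exists_half_mul_sq_le_inner {K U : Set V} {ν : V → V} {L α β : ℝ}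
    (hK : IsSmoothConvexBody K ν L) (hU : IsOpen U) (hKU : frontier K ⊆ U)
    (hν : ContDiffOn ℝ 1 ν U) (hcurv : ∀ x ∈ frontier K, ∀ v ∈ (ℝ ∙ (ν x))ᗮ,
      α * ‖v‖ ^ 2 ≤ ⟪fderiv ℝ ν x v, v⟫) (hβ : 0 < β) (hβα : β < α) :
    ∃ δ > 0, ∀ z ∈ frontier K, ∀ x ∈ K, ‖x - z‖ ≤ δ → β / 2 * ‖x - z‖ ^ 2 ≤ ⟪z - x, ν z⟫ := by
  obtain ⟨M, hM0, hM⟩ := exists_bound_norm_fderiv hK.isCompact.isCompact_frontier hU hKU hν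
  obtain ⟨β', hβ', hβ'α⟩ := exists_between hβα
  obtain ⟨δ₀, hδ₀, happ⟩ := exists_uniform_fderiv_approx hK.isCompact.isCompact_frontier hU hKU hν
    (show 0 < (α - β') / 4 by linarith)
  have hL := hK.L_nonneg
  obtain ⟨δ, hδ, hd1, hd2, hd3, hd4⟩ : ∃ δ > 0, 2 * δ ≤ δ₀ ∧ 2 * (L * δ) ≤ 1 / 2 ∧
      4 * (L * δ) * M ≤ (α - β') / 2 ∧ β * δ * β' / 2 ≤ β' - β := by
    have hlim : ∀ c : ℝ, ∀ b > 0, ∀ᶠ δ in nhdsWithin (0 : ℝ) (Set.Ioi 0), c * δ ≤ b := by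
      intro c b hb
      have : Filter.Tendsto (fun δ : ℝ => c * δ) (nhds 0) (nhds (c * 0)) :=
        tendsto_const_nhds.mul Filter.tendsto_id
      rw [mul_zero] at this
      exact ((this.eventually_lt_const hb).filter_mono nhdsWithin_le_nhds).mono fun _ h => h.le
    obtain ⟨δ, h1, h2, h3, h4, h5⟩ := ((hlim 2 δ₀ hδ₀).and ((hlim (2 * L) (1 / 2) (by norm_num)).and
      ((hlim (4 * L * M) ((α - β') / 2) (by linarith)).and
      ((hlim (β * β' / 2) (β' - β) (by linarith)).and self_mem_nhdsWithin)))).exists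
    exact ⟨δ, h5, h1, by linarith, by linarith, by linarith⟩
  refine ⟨δ, hδ, fun z hz x hx hxz => ?_⟩
  have hνz := hK.norm_eq_one z hz
  set D := ⟪z - x, ν z⟫ with hDdef
  have hD0 : 0 ≤ D := by
    have := hK.inner_nonpos z hz x hx
    rw [← neg_sub z x, inner_neg_left] at this
    linarith
  obtain ⟨w, hw⟩ : ∃ w, w = x - z + D • ν z := ⟨_, rfl⟩
  have hwν : ⟪w, ν z⟫ = 0 := by
    rw [hw, inner_add_left, inner_smul_left, real_inner_self_eq_norm_sq, hνz, ← neg_sub z x,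
      inner_neg_left]
    simp [hDdef]
  have hxzw : x - z = w - D • ν z := by rw [hw]; abel
  have hnorm : ‖x - z‖ ^ 2 = ‖w‖ ^ 2 + D ^ 2 := by
    rw [hxzw, norm_sub_sq_real, inner_smul_right, hwν, norm_smul, hνz, Real.norm_eq_abs, mul_one,
      sq_abs]
    ring
  have hr0 := norm_nonneg w
  have hrδ : ‖w‖ ≤ δ := by
    refine le_trans ?_ hxz
    exact le_of_sq_le_sq (by nlinarith) (norm_nonneg _)
  have hDδ : D ≤ δ := by
    refine le_trans ?_ hxz
    exact le_of_sq_le_sq (by nlinarith) (norm_nonneg _)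
  suffices hmain : β' / 2 * ‖w‖ ^ 2 ≤ D by
    rw [hnorm]
    have h1 : D * (β * D) ≤ D * (β * δ) := by gcongr
    have h2 : 0 ≤ 1 - β * δ / 2 := by nlinarith
    nlinarith [mul_le_mul_of_nonneg_right hmain h2, mul_nonneg (sub_nonneg.2 hd4) (sq_nonneg ‖w‖)]
  rcases hr0.eq_or_lt with hr | hr
  · rw [← hr]; simpa using hD0
  obtain ⟨e, he⟩ : ∃ e, e = ‖w‖⁻¹ • w := ⟨_, rfl⟩
  have he1 : ‖e‖ = 1 := by rw [he, norm_smul, norm_inv, norm_norm, inv_mul_cancel₀ hr.ne']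
  have heν : ⟪e, ν z⟫ = 0 := by rw [he, inner_smul_left, hwν, mul_zero]
  have hwe : w = ‖w‖ • e := by rw [he, smul_smul, mul_inv_cancel₀ hr.ne', one_smul]
  -- the profile of the boundary above the segment in direction `e`
  have hq : ∀ p : ℝ, ∃ q, p ∈ Set.Icc 0 ‖w‖ → q ≤ D ∧ z + p • e - q • ν z ∈ frontier K := by
    intro p
    by_cases hp : p ∈ Set.Icc 0 ‖w‖
    · have hp1 : p / ‖w‖ ≤ 1 := (div_le_one hr).2 hp.2
      have hmem : z + p • e - (p / ‖w‖ * D) • ν z ∈ K := by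
        have h1 := hK.convex.add_smul_sub_mem (hK.isCompact.isClosed.frontier_subset hz) hx
          (t := p / ‖w‖) ⟨div_nonneg hp.1 hr.le, hp1⟩
        convert h1 using 1
        rw [hxzw, smul_sub, smul_smul, he, smul_smul, div_eq_mul_inv]
        abel
      obtain ⟨q, hq, hqm⟩ := hK.isCompact.exists_sub_smul_mem_frontier hνz hmem
      exact ⟨q, fun _ => ⟨hq.trans (mul_le_of_le_one_left hD0 hp1), hqm⟩⟩
    · exact ⟨0, fun h => absurd h hp⟩
  choose q hq using hq
  have hq0 : ∀ p ∈ Set.Icc 0 ‖w‖, 0 ≤ q p := fun p hp => by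
    have h1 := hK.inner_nonpos z hz _ (hK.isCompact.isClosed.frontier_subset (hq p hp).2)
    have h2 : z + p • e - q p • ν z - z = p • e - q p • ν z := by abel
    rw [h2, inner_sub_left, inner_smul_left, inner_smul_left, heν, real_inner_self_eq_norm_sq,
      hνz] at h1
    simp at h1
    exact h1
  have hslope : ∀ p ∈ Set.Icc 0 ‖w‖, β' * p ≤ ⟪e, ν (z + p • e - q p • ν z)⟫ ∧
      0 < ⟪ν z, ν (z + p • e - q p • ν z)⟫ ∧ ⟪ν z, ν (z + p • e - q p • ν z)⟫ ≤ 1 := by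
    intro p hp
    obtain ⟨hqD, hy⟩ := hq p hp
    have hq0p := hq0 p hp
    obtain ⟨y, hydef⟩ : ∃ y, y = z + p • e - q p • ν z := ⟨_, rfl⟩
    rw [← hydef] at hy ⊢
    have hyz : y - z = p • e - q p • ν z := by rw [hydef]; abel
    have hnyz : ‖y - z‖ ≤ p + q p := by
      rw [hyz]
      refine (norm_sub_le _ _).trans_eq ?_
      rw [norm_smul, norm_smul, he1, hνz, Real.norm_of_nonneg hp.1, Real.norm_of_nonneg hq0p]
      ring
    have hp0 := hp.1
    have hpr := hp.2
    have hlip : ‖ν y - ν z‖ ≤ 2 * (L * δ) :=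
      (hK.lipschitz y hy z hz).trans <| by nlinarith
    have hνy := hK.norm_eq_one y hy
    have hinn := inner_eq_one_sub_of_norm_eq_one hνz hνy
    rw [norm_sub_rev] at hinn
    have hpos : 1 / 2 ≤ ⟪ν z, ν y⟫ := by nlinarith [norm_nonneg (ν y - ν z)]
    have heq : ⟪e, ν y⟫ = ⟪e, ν y - ν z⟫ := by rw [inner_sub_right, heν, sub_zero]
    have heup : ⟪e, ν y⟫ ≤ 2 * (L * δ) := by
      rw [heq]
      have := real_inner_le_norm e (ν y - ν z)
      rw [he1, one_mul] at this
      exact this.trans hlip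
    have hsup := hK.inner_nonpos y hy z (hK.isCompact.isClosed.frontier_subset hz)
    have h3 : z - y = q p • ν z - p • e := by rw [hydef]; abel
    rw [h3, inner_sub_left, inner_smul_left, inner_smul_left] at hsup
    simp only [conj_trivial] at hsup
    have hLδ : 0 ≤ L * δ := by positivity
    have hqp : q p ≤ 4 * (L * δ) * p := by
      have h4 := mul_le_mul_of_nonneg_left hpos hq0p
      have h5 := mul_le_mul_of_nonneg_left heup hp0
      linarith
    have hqp' : q p ≤ p := by
      have h4 : 4 * (L * δ) * p ≤ 1 * p := by gcongr; linarith
      linarith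
    refine ⟨?_, by linarith, by nlinarith [sq_nonneg ‖ν y - ν z‖]⟩
    have h4 := happ z hz y (hnyz.trans (by linarith))
    obtain ⟨A, hA⟩ : ∃ A, A = fderiv ℝ ν z := ⟨_, rfl⟩
    rw [← hA] at h4
    have h5 : α ≤ ⟪e, A e⟫ := by
      have := hcurv z hz e (by rw [Submodule.mem_orthogonal_singleton_iff_inner_left]; exact heν)
      rwa [he1, one_pow, mul_one, real_inner_comm, ← hA] at this
    have h6 : |⟪e, A (ν z)⟫| ≤ M := by
      refine (abs_real_inner_le_norm _ _).trans ?_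
      rw [he1, one_mul]
      exact (A.le_of_opNorm_le (hA ▸ hM z hz) _).trans_eq (by rw [hνz, mul_one])
    have h7 : |⟪e, ν y - ν z - A (y - z)⟫| ≤ (α - β') / 4 * (p + q p) := by
      refine (abs_real_inner_le_norm _ _).trans ?_
      rw [he1, one_mul]
      refine h4.trans ?_
      have : 0 ≤ (α - β') / 4 := by linarith
      gcongr
    rw [heq]
    have h8 : ⟪e, ν y - ν z⟫ = p * ⟪e, A e⟫ - q p * ⟪e, A (ν z)⟫ +
        ⟪e, ν y - ν z - A (y - z)⟫ := by
      rw [inner_sub_right _ (ν y - ν z), hyz, map_sub, map_smul, map_smul,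
        inner_sub_right _ (p • _),
        inner_smul_right, inner_smul_right]
      ring
    rw [h8]
    have h9 := (abs_le.1 h7).1
    have h10 : q p * ⟪e, A (ν z)⟫ ≤ q p * M := by gcongr; exact (abs_le.1 h6).2
    have h11 : q p * M ≤ (α - β') / 2 * p := by
      calc q p * M ≤ 4 * (L * δ) * p * M := by gcongr
        _ = 4 * (L * δ) * M * p := by ring
        _ ≤ _ := by gcongr
    have h12 : p * α ≤ p * ⟪e, A e⟫ := by gcongr
    have h13 : (α - β') / 4 * (p + q p) ≤ (α - β') / 4 * (p + p) := by
      have : 0 ≤ (α - β') / 4 := by linarith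
      gcongr
    linarith
  have hinc := half_mul_sq_le_sub_of_increment (f := q) (c := β') hr0 fun p p' hp hpp' hp' => by
    have hpm : p ∈ Set.Icc 0 ‖w‖ := ⟨hp, hpp'.trans hp'⟩
    have hpm' : p' ∈ Set.Icc 0 ‖w‖ := ⟨hp.trans hpp', hp'⟩
    obtain ⟨h1, h2, h3⟩ := hslope p hpm
    have h4 := hK.inner_nonpos _ (hq p hpm).2 _
      (hK.isCompact.isClosed.frontier_subset (hq p' hpm').2)
    have h5 : z + p' • e - q p' • ν z - (z + p • e - q p • ν z) =
      (p' - p) • e - (q p' - q p) • ν z := by rw [sub_smul, sub_smul]; abel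
    rw [h5, inner_sub_left, inner_smul_left, inner_smul_left] at h4
    simp only [conj_trivial] at h4
    have h6 : β' * p * (p' - p) ≤ (p' - p) * ⟪e, ν (z + p • e - q p • ν z)⟫ := by
      rw [mul_comm]; gcongr
    have h7 : 0 ≤ β' * p * (p' - p) :=
      mul_nonneg (mul_nonneg (by linarith) hp) (by linarith)
    have h8 : 0 ≤ q p' - q p := nonneg_of_mul_nonneg_left (by linarith) h2
    have h9 := mul_le_mul_of_nonneg_left h3 h8
    linarith
  have hf := hq0 0 ⟨le_rfl, hr0⟩
  have := (hq ‖w‖ ⟨hr0, le_rfl⟩).1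
  linarith

end UniformConvexity

theorem IsPreconnected.inter_frontier_nonempty {X : Type*} [TopologicalSpace X] {s t : Set X}
    (hs : IsPreconnected s) (h1 : (s ∩ t).Nonempty) (h2 : (s ∩ tᶜ).Nonempty) :
    (s ∩ frontier t).Nonempty := by
  by_contra hcon
  rw [Set.not_nonempty_iff_eq_empty, ← Set.disjoint_iff_inter_eq_empty] at hcon
  have h3 : ∀ x ∈ s, x ∈ closure t → x ∈ interior t := fun x hx hxt => by
    by_contra h
    exact Set.disjoint_left.1 hcon hx ⟨hxt, h⟩
  obtain ⟨x, hx, hx1, hx2⟩ := hs (interior t) (closure t)ᶜ isOpen_interior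
    isClosed_closure.isOpen_compl (fun x hx => by
      by_cases h : x ∈ closure t
      · exact Or.inl (h3 x hx h)
      · exact Or.inr h)
    (h1.mono fun x hx => ⟨hx.1, h3 x hx.1 (subset_closure hx.2)⟩)
    (h2.mono fun x hx => ⟨hx.1, fun h => hx.2 (interior_subset (h3 x hx.1 h))⟩)
  exact hx2 (subset_closure (interior_subset hx1))

section Tube

variable {V : Type*} [NormedAddCommGroup V] [InnerProductSpace ℝ V] {K : Set V} {ν : V → V} {L : ℝ}

namespace IsSmoothConvexBody

variable (hK : IsSmoothConvexBody K ν L)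
include hK

theorem frontier_subset : frontier K ⊆ K := hK.isCompact.isClosed.frontier_subset

theorem inner_nonneg {x z : V} (hz : z ∈ frontier K) (hx : x ∈ K) : 0 ≤ ⟪z - x, ν z⟫ := by
  have := hK.inner_nonpos z hz x hx
  rwa [← neg_sub z x, inner_neg_left, neg_nonpos] at this

theorem inner_le_mul_sq {x z : V} (hz : z ∈ frontier K) (hx : x ∈ frontier K) :
    ⟪z - x, ν z⟫ ≤ L * ‖x - z‖ ^ 2 := by
  have h1 := hK.inner_nonpos x hx z (hK.frontier_subset hz)
  have h2 : ⟪z - x, ν z⟫ = ⟪z - x, ν z - ν x⟫ + ⟪z - x, ν x⟫ := by rw [inner_sub_right]; ring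
  have h3 := real_inner_le_norm (z - x) (ν z - ν x)
  have h4 := mul_le_mul_of_nonneg_left (hK.lipschitz z hz x hx) (norm_nonneg (z - x))
  rw [norm_sub_rev x z]
  linarith [mul_comm ‖z - x‖ (L * ‖z - x‖), sq ‖z - x‖, mul_assoc L ‖z - x‖ ‖z - x‖]

theorem norm_add_smul_sq {x z : V} (hz : z ∈ frontier K) (ρ : ℝ) :
    ‖x - (z - ρ • ν z)‖ ^ 2 = ‖x - z‖ ^ 2 - 2 * ρ * ⟪z - x, ν z⟫ + ρ ^ 2 := by
  have h1 : x - (z - ρ • ν z) = ρ • ν z - (z - x) := by abel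
  rw [h1, norm_sub_sq_real, norm_smul, hK.norm_eq_one z hz, inner_smul_left, real_inner_comm,
    Real.norm_eq_abs, mul_one, sq_abs, norm_sub_rev x z]
  simp
  ring

theorem closedBall_subset {z : V} (hz : z ∈ frontier K) {ρ : ℝ} (hρ : 0 < ρ)
    (hρL : 2 * ρ * L ≤ 1) : closedBall (z - ρ • ν z) ρ ⊆ K := by
  suffices h : ball (z - ρ • ν z) ρ ⊆ K by
    rw [← closure_ball _ hρ.ne']
    exact hK.isCompact.isClosed.closure_subset_iff.2 h
  have hdisj : Disjoint (ball (z - ρ • ν z) ρ) (frontier K) := by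
    refine Set.disjoint_left.2 fun x hx hxK => ?_
    rw [mem_ball, dist_eq_norm] at hx
    have h1 := hK.norm_add_smul_sq (x := x) hz ρ
    have h2 := hK.inner_le_mul_sq hz hxK
    have h3 : ‖x - (z - ρ • ν z)‖ ^ 2 < ρ ^ 2 := by gcongr
    have h4 := mul_le_mul_of_nonneg_left h2 (show 0 ≤ 2 * ρ by positivity)
    have h5 := mul_le_mul_of_nonneg_right hρL (sq_nonneg ‖x - z‖)
    nlinarith
  -- the ball meets the interior
  obtain ⟨c, hc⟩ := hK.nonempty_interior
  have hcpos : 0 < ⟪z - c, ν z⟫ := by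
    obtain ⟨ε, hε, hb⟩ := Metric.nhds_basis_closedBall.mem_iff.1 (mem_interior_iff_mem_nhds.1 hc)
    have h1 : c + ε • ν z ∈ K := hb (by
      rw [mem_closedBall, dist_eq_norm, add_sub_cancel_left, norm_smul, hK.norm_eq_one z hz,
        Real.norm_of_nonneg hε.le, mul_one])
    have h2 := hK.inner_nonneg hz h1
    rw [← sub_sub, inner_sub_left, inner_smul_left, real_inner_self_eq_norm_sq,
      hK.norm_eq_one z hz] at h2
    simp at h2
    linarith
  obtain ⟨t, ht0, ht1, ht⟩ : ∃ t > 0, t ≤ 1 ∧ t * ‖c - z‖ ^ 2 < 2 * ρ * ⟪z - c, ν z⟫ := by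
    have hp : 0 < 2 * ρ * ⟪z - c, ν z⟫ := by positivity
    have : Filter.Tendsto (fun t : ℝ => t * ‖c - z‖ ^ 2) (nhds 0) (nhds (0 * ‖c - z‖ ^ 2)) :=
      Filter.tendsto_id.mul tendsto_const_nhds
    rw [zero_mul] at this
    have h1 := (this.eventually_lt_const hp).filter_mono (nhdsWithin_le_nhds (s := Set.Ioi 0))
    have h2 := (eventually_lt_nhds (zero_lt_one (α := ℝ))).filter_mono
      (nhdsWithin_le_nhds (s := Set.Ioi 0))
    obtain ⟨t, h3, h4, h5⟩ := (h1.and (h2.and self_mem_nhdsWithin)).exists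
    exact ⟨t, h5, h4.le, h3⟩
  have hmemK : z + t • (c - z) ∈ interior K := by
    rw [add_comm, ← AffineMap.lineMap_apply_module' (k := ℝ)]
    have := hK.convex.openSegment_closure_interior_subset_interior
      (subset_closure (hK.frontier_subset hz)) hc
    rcases ht1.eq_or_lt with rfl | h
    · simpa using hc
    · exact this (openSegment_eq_image_lineMap ℝ z c ▸ ⟨t, ⟨ht0, h⟩, rfl⟩)
  have hmemB : z + t • (c - z) ∈ ball (z - ρ • ν z) ρ := by
    rw [mem_ball, dist_eq_norm]
    refine lt_of_pow_lt_pow_left₀ 2 hρ.le ?_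
    rw [hK.norm_add_smul_sq hz, add_sub_cancel_left, norm_smul, Real.norm_of_nonneg ht0.le,
      show z - (z + t • (c - z)) = t • (z - c) by rw [smul_sub, smul_sub]; abel, inner_smul_left]
    simp only [conj_trivial]
    nlinarith
  have hpre := (convex_ball (z - ρ • ν z) ρ).isPreconnected
  by_contra hcon
  have h1 := hpre.inter_frontier_nonempty (t := K) ⟨_, hmemB, interior_subset hmemK⟩ (by
    rw [Set.not_subset] at hcon
    exact hcon.imp fun a ha => ha)
  exact (Set.disjoint_iff_inter_eq_empty.1 hdisj ▸ h1).ne_empty rfl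

theorem exists_pos_two_mul_le : ∃ ρ > 0, 2 * ρ * L ≤ 1 := by
  have := hK.L_nonneg
  refine ⟨1 / (2 * (L + 1)), by positivity, ?_⟩
  rw [show 2 * (1 / (2 * (L + 1))) * L = L / (L + 1) by field_simp, div_le_one (by positivity)]
  linarith

theorem eq_of_supporting {z n : V} (hz : z ∈ frontier K) (hn : ‖n‖ = 1)
    (h : ∀ y ∈ K, ⟪y - z, n⟫ ≤ 0) : n = ν z := by
  obtain ⟨ρ, hρ, hρL⟩ := hK.exists_pos_two_mul_le
  have h1 := h (z - ρ • ν z + ρ • n) (hK.closedBall_subset hz hρ hρL (by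
    rw [mem_closedBall, dist_eq_norm, add_sub_cancel_left, norm_smul, hn,
      Real.norm_of_nonneg hρ.le, mul_one]))
  rw [show z - ρ • ν z + ρ • n - z = ρ • (n - ν z) by rw [smul_sub]; abel, inner_smul_left,
    inner_sub_left, real_inner_self_eq_norm_sq, hn,
    inner_eq_one_sub_of_norm_eq_one (hK.norm_eq_one z hz) hn] at h1
  simp only [conj_trivial, one_pow, sub_sub_cancel] at h1
  have h2 : ‖ν z - n‖ ^ 2 / 2 ≤ 0 := by
    by_contra! hc
    have := mul_pos hρ hc
    linarith
  have h3 : ‖ν z - n‖ = 0 := by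
    have := sq_nonneg ‖ν z - n‖
    exact pow_eq_zero_iff two_ne_zero |>.1 (by linarith)
  exact (sub_eq_zero.1 (norm_eq_zero.1 h3)).symm

theorem exists_eq_add_smul_of_notMem {w : V} (hw : w ∉ K) :
    ∃ z ∈ frontier K, ∃ s : ℝ, 0 < s ∧ w = z + s • ν z := by
  obtain ⟨z, hz, hmin⟩ := hK.isCompact.exists_infDist_eq_dist
    (hK.nonempty_interior.mono interior_subset) w
  have hne : z ≠ w := fun h => hw (h ▸ hz)
  have hpos : 0 < ‖w - z‖ := norm_pos_iff.2 (sub_ne_zero.2 hne.symm)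
  have hsup : ∀ y ∈ K, ⟪w - z, y - z⟫ ≤ 0 := by
    refine (norm_eq_iInf_iff_real_inner_le_zero hK.convex hz).1 ?_
    rw [← dist_eq_norm, ← hmin, Metric.infDist_eq_iInf]
    simp [dist_eq_norm]
  have hzf : z ∈ frontier K := by
    refine ⟨subset_closure hz, fun hintegral => ?_⟩
    obtain ⟨ε, hε, hb⟩ :=
      Metric.nhds_basis_closedBall.mem_iff.1 (mem_interior_iff_mem_nhds.1 hintegral)
    have h1 : z + (ε / ‖w - z‖) • (w - z) ∈ K := hb (by
      rw [mem_closedBall, dist_eq_norm, add_sub_cancel_left, norm_smul,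
        Real.norm_of_nonneg (by positivity), div_mul_cancel₀ _ hpos.ne'])
    have h2 := hsup _ h1
    rw [add_sub_cancel_left, inner_smul_right, real_inner_self_eq_norm_sq] at h2
    have : 0 < ε / ‖w - z‖ * ‖w - z‖ ^ 2 := by positivity
    linarith
  refine ⟨z, hzf, ‖w - z‖, hpos, ?_⟩
  rw [← hK.eq_of_supporting hzf (n := ‖w - z‖⁻¹ • (w - z))
    (by rw [norm_smul, norm_inv, norm_norm, inv_mul_cancel₀ hpos.ne']) fun y hy => by
      rw [inner_smul_right, real_inner_comm]
      exact mul_nonpos_of_nonneg_of_nonpos (by positivity) (hsup y hy),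
    smul_smul, mul_inv_cancel₀ hpos.ne', one_smul, add_sub_cancel]

theorem add_smul_notMem {x : V} (hx : x ∈ frontier K) {u : ℝ} (hu : 0 < u) :
    x + u • ν x ∉ K := fun h => by
  have := hK.inner_nonpos x hx _ h
  rw [add_sub_cancel_left, inner_smul_left, real_inner_self_eq_norm_sq, hK.norm_eq_one x hx] at this
  simp at this
  linarith

theorem inner_le_neg_of_closedBall_subset {a z : V} (hz : z ∈ frontier K) {d : ℝ} (hd : 0 ≤ d)
    (h : closedBall a d ⊆ K) : ⟪a - z, ν z⟫ ≤ -d := by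
  have h1 := hK.inner_nonpos z hz (a + d • ν z) (h (by
    rw [mem_closedBall, dist_eq_norm, add_sub_cancel_left, norm_smul, hK.norm_eq_one z hz,
      Real.norm_of_nonneg hd, mul_one]))
  rw [show a + d • ν z - z = (a - z) + d • ν z by abel, inner_add_left, inner_smul_left,
    real_inner_self_eq_norm_sq, hK.norm_eq_one z hz] at h1
  simp at h1
  linarith

theorem exists_eq_sub_smul_of_mem [Nontrivial V] {a : V} (ha : a ∈ K) :
    ∃ z ∈ frontier K, ∃ d : ℝ, 0 ≤ d ∧ a = z - d • ν z ∧ closedBall a d ⊆ K := by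
  have hne : (frontier K).Nonempty := by
    rw [nonempty_frontier_iff]
    refine ⟨⟨a, ha⟩, fun h => ?_⟩
    obtain ⟨R, hR⟩ := hK.isCompact.isBounded.exists_norm_le
    obtain ⟨v, hv⟩ := NormedSpace.exists_lt_norm ℝ V R
    exact absurd (hR v (h ▸ Set.mem_univ v)) hv.not_ge
  obtain ⟨z, hz, hmin⟩ := hK.isCompact.isCompact_frontier.exists_infDist_eq_dist hne a
  have hball : closedBall a (dist a z) ⊆ K := by
    rcases (dist_nonneg (x := a) (y := z)).eq_or_lt with h0 | h0
    · rw [← h0]; simpa using ha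
    rw [← closure_ball _ h0.ne']
    refine hK.isCompact.isClosed.closure_subset_iff.2 ?_
    by_contra hcon
    obtain ⟨y, hy, hyf⟩ := (convex_ball a (dist a z)).isPreconnected.inter_frontier_nonempty
      (t := K) ⟨a, mem_ball_self h0, ha⟩ (by
        rw [Set.not_subset] at hcon
        exact hcon.imp fun a ha => ha)
    have := Metric.infDist_le_dist_of_mem (x := a) hyf
    rw [mem_ball, dist_comm] at hy
    linarith
  have h1 := hK.inner_le_neg_of_closedBall_subset hz dist_nonneg hball
  refine ⟨z, hz, dist a z, dist_nonneg, ?_, hball⟩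
  have h2 := hK.norm_add_smul_sq (x := a) hz (dist a z)
  rw [← neg_sub z a, inner_neg_left] at h1
  rw [← dist_eq_norm a z] at h2
  have h3 : ‖a - (z - dist a z • ν z)‖ ^ 2 ≤ 0 := by
    have := mul_le_mul_of_nonneg_left h1 (dist_nonneg (x := a) (y := z))
    nlinarith
  have h4 : ‖a - (z - dist a z • ν z)‖ = 0 :=
    pow_eq_zero_iff two_ne_zero |>.1 (le_antisymm h3 (sq_nonneg _))
  exact sub_eq_zero.1 (norm_eq_zero.1 h4)

end IsSmoothConvexBody

/-- Smooth convex bodies whose boundary satisfies a local quadratic support bound. -/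
structure IsUniformlyConvexBody (K : Set V) (ν : V → V) (L β δ : ℝ) : Prop
    extends IsSmoothConvexBody K ν L where
  β_pos : 0 < β
  δ_pos : 0 < δ
  half_mul_sq_le : ∀ z ∈ frontier K, ∀ x ∈ K, ‖x - z‖ ≤ δ → β / 2 * ‖x - z‖ ^ 2 ≤ ⟪z - x, ν z⟫

namespace IsUniformlyConvexBody

variable {β δ : ℝ} (hK : IsUniformlyConvexBody K ν L β δ)
include hK

theorem mul_norm_le_inner {x z : V} (hz : z ∈ frontier K) (hx : x ∈ K) (hxz : δ ≤ ‖x - z‖) :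
    β * δ / 2 * ‖x - z‖ ≤ ⟪z - x, ν z⟫ := by
  have hδ := hK.δ_pos
  have hpos : 0 < ‖x - z‖ := hδ.trans_le hxz
  have hmem := hK.convex.add_smul_sub_mem (hK.frontier_subset hz) hx
    (t := δ / ‖x - z‖) ⟨by positivity, (div_le_one hpos).2 hxz⟩
  have hn : ‖z + (δ / ‖x - z‖) • (x - z) - z‖ = δ := by
    rw [add_sub_cancel_left, norm_smul, Real.norm_of_nonneg (by positivity),
      div_mul_cancel₀ _ hpos.ne']
  have h1 := hK.half_mul_sq_le z hz _ hmem hn.le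
  rw [hn, show z - (z + (δ / ‖x - z‖) • (x - z)) = (δ / ‖x - z‖) • (z - x) by
    rw [smul_sub, smul_sub]; abel, inner_smul_left] at h1
  simp only [conj_trivial] at h1
  rw [div_mul_eq_mul_div (a := δ), le_div_iff₀ hpos] at h1
  have h2 : δ * (β * δ / 2 * ‖x - z‖) ≤ δ * ⟪z - x, ν z⟫ := by linarith
  exact le_of_mul_le_mul_left h2 hδ

theorem mul_sq_le_inner_sub {x y : V} (hx : x ∈ frontier K) (hy : y ∈ frontier K)
    (hxy : ‖x - y‖ ≤ δ) : β * ‖x - y‖ ^ 2 ≤ ⟪x - y, ν x - ν y⟫ := by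
  have h1 := hK.half_mul_sq_le y hy x (hK.frontier_subset hx) hxy
  have h2 := hK.half_mul_sq_le x hx y (hK.frontier_subset hy) (by rwa [norm_sub_rev])
  rw [norm_sub_rev y x] at h2
  rw [inner_sub_right]
  rw [← neg_sub x y, inner_neg_left] at h1
  linarith

theorem exists_mul_sq_norm_sub_le_inner :
    ∃ κ > 0, ∀ x ∈ frontier K, ∀ z ∈ frontier K, κ * ‖ν x - ν z‖ ^ 2 ≤ ⟪z - x, ν z⟫ := by
  have hβ := hK.β_pos
  have hδ := hK.δ_pos
  have hL := hK.L_nonneg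
  refine ⟨min (β / (2 * (L ^ 2 + 1))) (β * δ ^ 2 / 8), by positivity, fun x hx z hz => ?_⟩
  rcases le_total ‖x - z‖ δ with h | h
  · refine le_trans ?_ (hK.half_mul_sq_le z hz x (hK.frontier_subset hx) h)
    have h1 : ‖ν x - ν z‖ ^ 2 ≤ (L ^ 2 + 1) * ‖x - z‖ ^ 2 := by
      have := pow_le_pow_left₀ (norm_nonneg _) (hK.lipschitz x hx z hz) 2
      nlinarith [sq_nonneg ‖x - z‖]
    calc _ ≤ β / (2 * (L ^ 2 + 1)) * ((L ^ 2 + 1) * ‖x - z‖ ^ 2) := by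
          gcongr; exact min_le_left _ _
      _ = _ := by field_simp
  · refine le_trans ?_ (hK.mul_norm_le_inner hz (hK.frontier_subset hx) h)
    have h1 : ‖ν x - ν z‖ ≤ 2 :=
      (norm_sub_le _ _).trans (by rw [hK.norm_eq_one x hx, hK.norm_eq_one z hz]; norm_num)
    calc _ ≤ β * δ ^ 2 / 8 * 2 ^ 2 := by gcongr; exact min_le_right _ _
      _ = β * δ / 2 * δ := by ring
      _ ≤ _ := by gcongr

theorem injOn_tube {κ : ℝ} (hκ0 : 0 < κ) (hκ : ∀ x ∈ frontier K, ∀ z ∈ frontier K,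
    κ * ‖ν x - ν z‖ ^ 2 ≤ ⟪z - x, ν z⟫) {x y : V} (hx : x ∈ frontier K) (hy : y ∈ frontier K)
    {u v : ℝ} (hu : -κ < u) (hv : -κ < v) (h : x + u • ν x = y + v • ν y) : x = y ∧ u = v := by
  have h1 : x - y = v • ν y - u • ν x := by
    rw [sub_eq_sub_iff_add_eq_add, h]; abel
  have hc := inner_eq_one_sub_of_norm_eq_one (hK.norm_eq_one x hx) (hK.norm_eq_one y hy)
  have h2 : ⟪x - y, ν x - ν y⟫ = -(u + v) * (‖ν x - ν y‖ ^ 2 / 2) := by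
    rw [h1]
    simp only [inner_sub_left, inner_sub_right, inner_smul_left, real_inner_self_eq_norm_sq,
      hK.norm_eq_one x hx, hK.norm_eq_one y hy, real_inner_comm (ν x) (ν y), hc, conj_trivial]
    ring
  have h3 := hκ x hx y hy
  have h4 := hκ y hy x hx
  rw [norm_sub_rev (ν y)] at h4
  have h5 : ⟪x - y, ν x - ν y⟫ = ⟪x - y, ν x⟫ + ⟪y - x, ν y⟫ := by
    rw [inner_sub_right, ← neg_sub y x, inner_neg_left (y - x) (ν y)]; ring
  have h6 : ‖ν x - ν y‖ = 0 := by
    by_contra hne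
    have : 0 < ‖ν x - ν y‖ ^ 2 := by positivity
    have h10 : -(u + v) / 2 * ‖ν x - ν y‖ ^ 2 < κ * ‖ν x - ν y‖ ^ 2 := by gcongr; linarith
    have h11 := mul_pos hκ0 this
    linarith
  have h7 : ν x = ν y := sub_eq_zero.1 (norm_eq_zero.1 h6)
  have h8 := hK.inner_nonneg hx (hK.frontier_subset hy)
  have h9 := hK.inner_nonneg hy (hK.frontier_subset hx)
  rw [← neg_sub x y, inner_neg_left] at h9
  rw [h1, h7, ← sub_smul, inner_smul_left, real_inner_self_eq_norm_sq, hK.norm_eq_one y hy] at h8 h9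
  simp at h8 h9
  have huv : u = v := le_antisymm h8 h9
  refine ⟨?_, huv⟩
  rw [h7, huv] at h
  exact add_right_cancel h

end IsUniformlyConvexBody

end Tube

section Hausdorff

open scoped NNReal

variable {X Y : Type*} [MetricSpace X] [MeasurableSpace X] [BorelSpace X]
  [MetricSpace Y] [MeasurableSpace Y] [BorelSpace Y]

theorem LipschitzOnWith.euclideanHausdorffMeasure_image_le {C : ℝ≥0} {f : X → Y} {s : Set X}
    (hf : LipschitzOnWith C f s) (k : ℕ) : μHE[k] (f '' s) ≤ C ^ k * μHE[k] s := by
  have h := hf.hausdorffMeasure_image_le (d := k) (Nat.cast_nonneg k)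
  rw [ENNReal.rpow_natCast] at h
  simp only [Measure.euclideanHausdorffMeasure_def, Measure.smul_apply]
  rw [mul_smul_comm]
  gcongr

theorem euclideanHausdorffMeasure_le_mul_image {C : ℝ≥0} {f : X → Y} {s : Set X}
    (hf : ∀ x ∈ s, ∀ y ∈ s, dist x y ≤ C * dist (f x) (f y)) (k : ℕ) :
    μHE[k] s ≤ C ^ k * μHE[k] (f '' s) := by
  rcases s.eq_empty_or_nonempty with rfl | ⟨x₀, hx₀⟩
  · simp
  have : Nonempty X := ⟨x₀⟩
  have hinj : Set.InjOn f s := fun x hx y hy hxy => by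
    have := hf x hx y hy
    rw [hxy, dist_self, mul_zero] at this
    exact dist_le_zero.1 this
  have hinv := hinj.leftInvOn_invFunOn
  have himg : Function.invFunOn f s '' (f '' s) = s := hinv.image_image
  have hlip : LipschitzOnWith C (Function.invFunOn f s) (f '' s) := by
    refine LipschitzOnWith.of_dist_le_mul ?_
    rintro _ ⟨x, hx, rfl⟩ _ ⟨y, hy, rfl⟩
    rw [hinv hx, hinv hy]
    exact hf x hx y hy
  simpa only [himg] using hlip.euclideanHausdorffMeasure_image_le k

end Hausdorff

section Slicing

open scoped NNReal

variable {V : Type*} [NormedAddCommGroup V] [InnerProductSpace ℝ V] [FiniteDimensional ℝ V]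
  [MeasurableSpace V] [BorelSpace V]

theorem volume_eq_lintegral_slices {e : V} (he : ‖e‖ = 1) {t : Set V} (ht : MeasurableSet t) :
    volume t = ∫⁻ u : ℝ, volume {y : (ℝ ∙ e)ᗮ | (y : V) + u • e ∈ t} := by
  have he0 : e ≠ 0 := fun h => by simp [h] at he
  have hdim : Module.finrank ℝ (ℝ ∙ e)ᗮ = Module.finrank ℝ V - 1 := by
    have h1 := (ℝ ∙ e).finrank_add_finrank_orthogonal
    rw [finrank_span_singleton he0] at h1
    omega
  rw [← InnerProductSpace.euclideanHausdorffMeasure_eq_volume (V := V),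
    EuclideanGeometry.euclideanHausdorffMeasure_eq_lintegral (0 : V) he0 ht, ← ofReal_norm,
    he, ENNReal.ofReal_one, one_mul, ← hdim]
  refine lintegral_congr fun u => ?_
  have hiso : Isometry fun y : (ℝ ∙ e)ᗮ => (y : V) + u • e := fun x y => by simp [Subtype.edist_eq]
  rw [← InnerProductSpace.euclideanHausdorffMeasure_eq_volume (V := (ℝ ∙ e)ᗮ),
    ← hiso.euclideanHausdorffMeasure_image]
  congr 1
  ext w
  simp only [Set.mem_inter_iff, SetLike.mem_coe, AffineSubspace.mem_mk', vsub_eq_sub, vadd_eq_add,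
    add_zero, Set.mem_image, Set.mem_ofPred_eq]
  constructor
  · rintro ⟨h1, h2⟩
    exact ⟨⟨_, h2⟩, by simpa using h1, by simp⟩
  · rintro ⟨y, hy, rfl⟩
    exact ⟨hy, by simp⟩

variable {X : Type*} [MetricSpace X] [PolishSpace X] [MeasurableSpace X] [BorelSpace X]
  {e : V} {h : X → (ℝ ∙ e)ᗮ} {N : Set X} {B : Set (X × ℝ)}

omit [FiniteDimensional ℝ V] [MeasurableSpace V] [BorelSpace V] [MetricSpace X] [PolishSpace X]
  [MeasurableSpace X] [BorelSpace X] in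
theorem injOn_graph (hinj : Set.InjOn h N) (he : ‖e‖ = 1) :
    Set.InjOn (fun p : X × ℝ => (h p.1 : V) + p.2 • e) {p | p.1 ∈ N} := by
  rintro ⟨x, u⟩ hx ⟨y, v⟩ hy hxy
  have hu : ∀ (z : (ℝ ∙ e)ᗮ) (s : ℝ), ⟪e, (z : V) + s • e⟫ = s := fun z s => by
    rw [inner_add_right, inner_smul_right, real_inner_self_eq_norm_sq, he,
      Submodule.mem_orthogonal_singleton_iff_inner_right.1 z.2]
    simp
  have huv : u = v := by
    rw [← hu (h x) u, ← hu (h y) v]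
    exact congrArg (fun w => ⟪e, w⟫) hxy
  subst huv
  exact Prod.ext (hinj hx hy (Subtype.ext (add_right_cancel hxy))) rfl

theorem volume_image_graph (he : ‖e‖ = 1) (hh : Continuous h) (hinj : Set.InjOn h N)
    (hB : MeasurableSet B) (hBN : ∀ p ∈ B, p.1 ∈ N) :
    volume ((fun p : X × ℝ => (h p.1 : V) + p.2 • e) '' B) =
      ∫⁻ u : ℝ, volume (h '' ((fun x => (x, u)) ⁻¹' B)) := by
  have hinjB := (injOn_graph hinj he).mono hBN
  rw [volume_eq_lintegral_slices he
    (hB.image_of_continuousOn_injOn (by fun_prop) hinjB)]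
  refine lintegral_congr fun u => ?_
  congr 1
  ext y
  simp only [Set.mem_image, Prod.exists, Set.mem_ofPred_eq, Set.mem_preimage]
  constructor
  · rintro ⟨x, v, hx, hxy⟩
    have h1 := injOn_graph (h := (id : (ℝ ∙ e)ᗮ → _)) (N := Set.univ) Function.injective_id.injOn he
    have := @h1 (h x, v) trivial (y, u) trivial hxy
    rw [Prod.mk.injEq] at this
    exact ⟨x, this.2 ▸ hx, this.1⟩
  · rintro ⟨x, hx, rfl⟩
    exact ⟨x, u, hx, rfl⟩

variable {k : ℕ} [SFinite (μHE[k] : Measure X)]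

theorem volume_image_graph_le (hk : Module.finrank ℝ (ℝ ∙ e)ᗮ = k) (he : ‖e‖ = 1)
    (hh : Continuous h) (hinj : Set.InjOn h N) {C : ℝ≥0} (hlip : LipschitzOnWith C h N)
    (hB : MeasurableSet B) (hBN : ∀ p ∈ B, p.1 ∈ N) :
    volume ((fun p : X × ℝ => (h p.1 : V) + p.2 • e) '' B) ≤
      C ^ k * ((μHE[k] : Measure X).prod volume) B := by
  rw [volume_image_graph he hh hinj hB hBN, Measure.prod_apply_symm hB,
    ← lintegral_const_mul' _ _ (by simp)]
  refine lintegral_mono fun u => ?_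
  rw [← InnerProductSpace.euclideanHausdorffMeasure_eq_volume (V := (ℝ ∙ e)ᗮ), hk]
  exact (hlip.mono fun x hx => hBN _ hx).euclideanHausdorffMeasure_image_le k

theorem le_mul_volume_image_graph (hk : Module.finrank ℝ (ℝ ∙ e)ᗮ = k) (he : ‖e‖ = 1)
    (hh : Continuous h) {C : ℝ≥0} (hanti : ∀ x ∈ N, ∀ y ∈ N, dist x y ≤ C * dist (h x) (h y))
    (hB : MeasurableSet B) (hBN : ∀ p ∈ B, p.1 ∈ N) :
    ((μHE[k] : Measure X).prod volume) B ≤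
      C ^ k * volume ((fun p : X × ℝ => (h p.1 : V) + p.2 • e) '' B) := by
  have hinj : Set.InjOn h N := fun x hx y hy hxy => by
    have := hanti x hx y hy
    rw [hxy, dist_self, mul_zero] at this
    exact dist_le_zero.1 this
  rw [volume_image_graph he hh hinj hB hBN, Measure.prod_apply_symm hB,
    ← lintegral_const_mul' _ _ (by simp)]
  refine lintegral_mono fun u => ?_
  rw [← InnerProductSpace.euclideanHausdorffMeasure_eq_volume (V := (ℝ ∙ e)ᗮ), hk]
  exact euclideanHausdorffMeasure_le_mul_image
    (fun x hx y hy => hanti x (hBN _ hx) y (hBN _ hy)) k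

end Slicing

section TubeMap

open scoped NNReal Topology

variable {V : Type*} [NormedAddCommGroup V] [InnerProductSpace ℝ V]

/-- The normal exponential map of the boundary of `K`. -/
def tubeMap (K : Set V) (ν : V → V) (p : frontier K × ℝ) : V := (p.1 : V) + p.2 • ν p.1

variable {K : Set V} {ν : V → V} {L : ℝ}

theorem norm_orthogonalProjectionOnto_sq {e : V} (he : ‖e‖ = 1) (v : V) :
    ‖(ℝ ∙ e)ᗮ.orthogonalProjectionOnto v‖ ^ 2 = ‖v‖ ^ 2 - ⟪v, e⟫ ^ 2 := by
  have h1 : (((ℝ ∙ e)ᗮ.orthogonalProjectionOnto v : (ℝ ∙ e)ᗮ) : V) = v - ⟪e, v⟫ • e := by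
    rw [Submodule.coe_orthogonalProjectionOnto_apply, Submodule.starProjection_orthogonal_val,
      Submodule.starProjection_unit_singleton ℝ he]
  rw [Submodule.coe_norm, h1, norm_sub_sq_real, inner_smul_right, norm_smul, he,
    real_inner_comm e v, Real.norm_eq_abs, mul_one, sq_abs]
  ring

namespace IsSmoothConvexBody

variable (hK : IsSmoothConvexBody K ν L)
include hK

theorem continuous_normal : Continuous fun x : frontier K => ν x :=
  (LipschitzWith.of_dist_le_mul (K := ⟨L, hK.L_nonneg⟩) fun x y => by
    rw [dist_eq_norm, Subtype.dist_eq, dist_eq_norm]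
    exact hK.lipschitz _ x.2 _ y.2).continuous

theorem continuous_tubeMap : Continuous (tubeMap K ν) := by
  have := hK.continuous_normal.comp (continuous_fst (X := frontier K) (Y := ℝ))
  exact (continuous_subtype_val.comp continuous_fst).add (continuous_snd.smul this)

theorem abs_inner_sub_le {x y z : V} {r : ℝ} (hx : x ∈ frontier K) (hy : y ∈ frontier K)
    (hz : z ∈ frontier K) (hxz : ‖x - z‖ ≤ r) (hyz : ‖y - z‖ ≤ r) (s : ℝ) :
    |⟪x + s • ν x - (y + s • ν y), ν z⟫| ≤ (3 * L + 2 * |s| * L ^ 2) * r * ‖x - y‖ := by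
  have hL := hK.L_nonneg
  have hxy : ‖x - y‖ ≤ 2 * r := by
    calc ‖x - y‖ = ‖(x - z) - (y - z)‖ := by congr 1; abel
      _ ≤ ‖x - z‖ + ‖y - z‖ := norm_sub_le _ _
      _ ≤ 2 * r := by linarith
  have hr : 0 ≤ r := (norm_nonneg _).trans hxz
  have hν : ‖ν x - ν z‖ ≤ L * r :=
    (hK.lipschitz _ hx _ hz).trans (by gcongr)
  have hνxy := hK.lipschitz _ hx _ hy
  have hsplit : ⟪x + s • ν x - (y + s • ν y), ν z⟫ =
      ⟪x - y, ν x⟫ - ⟪x - y, ν x - ν z⟫ + s * (⟪ν x - ν y, ν x⟫ - ⟪ν x - ν y, ν x - ν z⟫) := by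
    simp only [inner_sub_left, inner_sub_right, inner_add_left, real_inner_smul_left]
    ring
  have h1 : |⟪x - y, ν x⟫| ≤ 2 * L * r * ‖x - y‖ := by
    rw [abs_of_nonneg (hK.inner_nonneg hx (hK.frontier_subset hy))]
    calc _ ≤ L * ‖y - x‖ ^ 2 := hK.inner_le_mul_sq hx hy
      _ = L * ‖x - y‖ * ‖x - y‖ := by rw [norm_sub_rev]; ring
      _ ≤ L * (2 * r) * ‖x - y‖ := by gcongr
      _ = _ := by ring
  have h2 : |⟪x - y, ν x - ν z⟫| ≤ L * r * ‖x - y‖ :=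
    (abs_real_inner_le_norm _ _).trans (by nlinarith [norm_nonneg (x - y)])
  have h3 : |⟪ν x - ν y, ν x⟫| ≤ L ^ 2 * r * ‖x - y‖ := by
    have : ⟪ν x - ν y, ν x⟫ = ‖ν x - ν y‖ ^ 2 / 2 := by
      rw [inner_sub_left, real_inner_self_eq_norm_sq, hK.norm_eq_one _ hx,
        inner_eq_one_sub_of_norm_eq_one (hK.norm_eq_one _ hy) (hK.norm_eq_one _ hx),
        norm_sub_rev]
      ring
    rw [this, abs_of_nonneg (by positivity)]
    calc ‖ν x - ν y‖ ^ 2 / 2 ≤ (L * ‖x - y‖) ^ 2 / 2 := by gcongr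
      _ = L ^ 2 * ‖x - y‖ / 2 * ‖x - y‖ := by ring
      _ ≤ L ^ 2 * (2 * r) / 2 * ‖x - y‖ := by gcongr
      _ = _ := by ring
  have h4 : |⟪ν x - ν y, ν x - ν z⟫| ≤ L ^ 2 * r * ‖x - y‖ := by
    calc _ ≤ ‖ν x - ν y‖ * ‖ν x - ν z‖ := abs_real_inner_le_norm _ _
      _ ≤ (L * ‖x - y‖) * (L * r) := by gcongr
      _ = _ := by ring
  rw [hsplit]
  calc _ ≤ |⟪x - y, ν x⟫| + |⟪x - y, ν x - ν z⟫| +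
        |s| * (|⟪ν x - ν y, ν x⟫| + |⟪ν x - ν y, ν x - ν z⟫|) := by
        refine (abs_add_le _ _).trans ?_
        rw [abs_mul]
        gcongr <;> exact abs_sub _ _
    _ ≤ 2 * L * r * ‖x - y‖ + L * r * ‖x - y‖ +
        |s| * (L ^ 2 * r * ‖x - y‖ + L ^ 2 * r * ‖x - y‖) := by gcongr
    _ = _ := by ring

/-- In a small product neighbourhood the tube map factors through a graph over the tangent
hyperplane, up to a map that is close to the identity. -/
theorem exists_chart {c δ t ε : ℝ} {s : ℝ} (hc : 0 < c) (hδ : 0 < δ)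
    (hlow : ∀ x y : frontier K, dist x y ≤ δ →
      c * dist x y ≤ dist (tubeMap K ν (x, s)) (tubeMap K ν (y, s)))
    (x₀ : frontier K) (ht0 : 0 < t) (ht : t < 1) (hε : 0 < ε) :
    ∃ r > 0, ∀ x y : frontier K, dist x x₀ ≤ r → dist y x₀ ≤ r →
      t * c * dist x y ≤ dist ((ℝ ∙ ν x₀)ᗮ.orthogonalProjectionOnto (tubeMap K ν (x, s)))
        ((ℝ ∙ ν x₀)ᗮ.orthogonalProjectionOnto (tubeMap K ν (y, s))) ∧
      ∀ u v : ℝ, |u - s| ≤ r → |v - s| ≤ r →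
        ‖tubeMap K ν (x, u) - tubeMap K ν (y, v) -
          ((((ℝ ∙ ν x₀)ᗮ.orthogonalProjectionOnto (tubeMap K ν (x, s)) : (ℝ ∙ ν x₀)ᗮ) : V)
              + u • ν x₀ -
            ((((ℝ ∙ ν x₀)ᗮ.orthogonalProjectionOnto (tubeMap K ν (y, s)) : (ℝ ∙ ν x₀)ᗮ) : V)
              + v • ν x₀))‖ ≤
          ε * ‖(((ℝ ∙ ν x₀)ᗮ.orthogonalProjectionOnto (tubeMap K ν (x, s)) : (ℝ ∙ ν x₀)ᗮ) : V)
              + u • ν x₀ -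
            ((((ℝ ∙ ν x₀)ᗮ.orthogonalProjectionOnto (tubeMap K ν (y, s)) : (ℝ ∙ ν x₀)ᗮ) : V)
              + v • ν x₀)‖ := by
  have hL := hK.L_nonneg
  set M := 3 * L + 2 * |s| * L ^ 2 with hM
  have hM0 : 0 ≤ M := by positivity
  have htc : 0 < t * c := by positivity
  -- choose the radius
  have hev : ∀ᶠ r in 𝓝[>] (0 : ℝ), 2 * r ≤ δ ∧ (M * r) ^ 2 ≤ (1 - t ^ 2) * c ^ 2 ∧
      (M * r + r * L) / (t * c) + L * r ≤ ε := by
    have h1 : ∀ᶠ r in 𝓝 (0 : ℝ), 2 * r < δ :=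
      (by fun_prop : ContinuousAt (fun r : ℝ => 2 * r) 0).eventually_lt_const (by simpa)
    have h2 : ∀ᶠ r in 𝓝 (0 : ℝ), (M * r) ^ 2 < (1 - t ^ 2) * c ^ 2 :=
      (by fun_prop : ContinuousAt (fun r : ℝ => (M * r) ^ 2) 0).eventually_lt_const
        (by simp only [mul_zero]
            nlinarith [mul_pos (by nlinarith : 0 < 1 - t ^ 2) (sq_pos_of_pos hc)])
    have h3 : ∀ᶠ r in 𝓝 (0 : ℝ), (M * r + r * L) / (t * c) + L * r < ε :=
      (by fun_prop : ContinuousAt (fun r : ℝ => (M * r + r * L) / (t * c) + L * r) 0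
        ).eventually_lt_const (by simpa)
    filter_upwards [nhdsWithin_le_nhds h1, nhdsWithin_le_nhds h2, nhdsWithin_le_nhds h3]
      with r h1 h2 h3 using ⟨h1.le, h2.le, h3.le⟩
  obtain ⟨r, ⟨hrδ, hrM, hrε⟩, hr⟩ := (hev.and self_mem_nhdsWithin).exists
  have hr : 0 < r := hr
  refine ⟨r, hr, fun x y hx hy => ?_⟩
  have hν0 := hK.norm_eq_one _ x₀.2
  rw [Subtype.dist_eq, dist_eq_norm] at hx hy
  set P := (ℝ ∙ ν x₀)ᗮ.orthogonalProjectionOnto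
  set d := tubeMap K ν (x, s) - tubeMap K ν (y, s) with hd
  have hinner : |⟪d, ν x₀⟫| ≤ M * r * ‖(x : V) - y‖ :=
    hK.abs_inner_sub_le x.2 y.2 x₀.2 hx hy s
  have hxy2 : ‖(x : V) - y‖ ≤ δ := by
    calc ‖(x : V) - y‖ = ‖((x : V) - x₀) - (y - x₀)‖ := by congr 1; abel
      _ ≤ ‖(x : V) - x₀‖ + ‖(y : V) - x₀‖ := norm_sub_le _ _
      _ ≤ δ := by linarith
  have hlow' := hlow x y (by rwa [Subtype.dist_eq, dist_eq_norm])
  rw [dist_eq_norm (tubeMap K ν (x, s)), ← hd, Subtype.dist_eq, dist_eq_norm] at hlow'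
  have hPd : P (tubeMap K ν (x, s)) - P (tubeMap K ν (y, s)) = P d := (map_sub P _ _).symm
  have hsq : (t * c * ‖(x : V) - y‖) ^ 2 ≤ ‖P d‖ ^ 2 := by
    rw [norm_orthogonalProjectionOnto_sq hν0, ← sq_abs ⟪d, ν x₀⟫]
    have h1 := pow_le_pow_left₀ (by positivity) hlow' 2
    have h2 := pow_le_pow_left₀ (abs_nonneg _) hinner 2
    have h3 := mul_le_mul_of_nonneg_right hrM (sq_nonneg ‖(x : V) - y‖)
    nlinarith
  have hP : t * c * ‖(x : V) - y‖ ≤ ‖P d‖ := by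
    exact (pow_le_pow_iff_left₀ (by positivity) (norm_nonneg _) two_ne_zero).1 hsq
  refine ⟨by rw [dist_eq_norm (P _), hPd, Subtype.dist_eq, dist_eq_norm]; exact hP,
    fun u v hu hv => ?_⟩
  have hG : ((P (tubeMap K ν (x, s)) : (ℝ ∙ ν x₀)ᗮ) : V) + u • ν x₀ -
      (((P (tubeMap K ν (y, s)) : (ℝ ∙ ν x₀)ᗮ) : V) + v • ν x₀) =
      ((P d : (ℝ ∙ ν x₀)ᗮ) : V) + (u - v) • ν x₀ := by
    rw [← hPd, Submodule.coe_sub, sub_smul]; abel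
  rw [hG]
  set G := ((P d : (ℝ ∙ ν x₀)ᗮ) : V) + (u - v) • ν x₀ with hGdef
  have hGsq : ‖G‖ ^ 2 = ‖P d‖ ^ 2 + (u - v) ^ 2 := by
    have h0 : ⟪((P d : (ℝ ∙ ν x₀)ᗮ) : V), ν x₀⟫ = 0 := by
      rw [real_inner_comm]; exact Submodule.mem_orthogonal_singleton_iff_inner_right.1 (P d).2
    rw [hGdef, norm_add_sq_real, inner_smul_right, h0, norm_smul, hν0, Real.norm_eq_abs, mul_one,
      sq_abs, Submodule.coe_norm]
    ring
  have hG1 : ‖P d‖ ≤ ‖G‖ :=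
    (pow_le_pow_iff_left₀ (norm_nonneg _) (norm_nonneg _) two_ne_zero).1
      (by rw [hGsq]; nlinarith [sq_nonneg (u - v)])
  have hG2 : |u - v| ≤ ‖G‖ :=
    (pow_le_pow_iff_left₀ (abs_nonneg _) (norm_nonneg _) two_ne_zero).1
      (by rw [hGsq, sq_abs]; nlinarith [sq_nonneg ‖P d‖])
  have hPval : ((P d : (ℝ ∙ ν x₀)ᗮ) : V) = d - ⟪ν x₀, d⟫ • ν x₀ := by
    rw [Submodule.coe_orthogonalProjectionOnto_apply, Submodule.starProjection_orthogonal_val,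
      Submodule.starProjection_unit_singleton ℝ hν0]
  have herr : tubeMap K ν (x, u) - tubeMap K ν (y, v) - G =
      ⟪ν x₀, d⟫ • ν x₀ + (u - v) • (ν x - ν x₀) + (v - s) • (ν x - ν y) := by
    rw [hGdef, hPval, hd]
    simp only [tubeMap]
    module
  have hx1 : ‖(x : V) - y‖ ≤ ‖G‖ / (t * c) := by
    rw [le_div_iff₀ htc]; linarith
  have hνx : ‖ν x - ν x₀‖ ≤ L * r := (hK.lipschitz _ x.2 _ x₀.2).trans (by gcongr)
  have hνxy := hK.lipschitz _ x.2 _ y.2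
  rw [herr]
  calc _ ≤ ‖⟪ν x₀, d⟫ • ν x₀‖ + ‖(u - v) • (ν x - ν x₀)‖ + ‖(v - s) • (ν x - ν y)‖ :=
        norm_add₃_le
    _ ≤ M * r * ‖(x : V) - y‖ + ‖G‖ * (L * r) + r * (L * ‖(x : V) - y‖) := by
        simp only [norm_smul, Real.norm_eq_abs, hν0, mul_one]
        rw [real_inner_comm]
        gcongr
    _ = (M * r + r * L) * ‖(x : V) - y‖ + L * r * ‖G‖ := by ring
    _ ≤ (M * r + r * L) * (‖G‖ / (t * c)) + L * r * ‖G‖ := by gcongr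
    _ = ((M * r + r * L) / (t * c) + L * r) * ‖G‖ := by ring
    _ ≤ ε * ‖G‖ := by gcongr

end IsSmoothConvexBody

end TubeMap

section LocalComparison

open scoped NNReal Topology

variable {V : Type*} [NormedAddCommGroup V] [InnerProductSpace ℝ V] [FiniteDimensional ℝ V]
  [MeasurableSpace V] [BorelSpace V]

omit [FiniteDimensional ℝ V] [MeasurableSpace V] [BorelSpace V] in
theorem exists_approximatesLinearOn_id {T : Type*} [Nonempty T] {B : Set T} {F G : T → V} {ε : ℝ≥0}
    (h : ∀ p ∈ B, ∀ q ∈ B, ‖F p - F q - (G p - G q)‖ ≤ ε * ‖G p - G q‖) :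
    ∃ f : V → V, ApproximatesLinearOn f (ContinuousLinearMap.id ℝ V) (G '' B) ε ∧
      f '' (G '' B) = F '' B := by
  have hF : ∀ p ∈ B, F (Function.invFunOn G B (G p)) = F p := fun p hp => by
    have hmem : G p ∈ G '' B := ⟨p, hp, rfl⟩
    have h1 := h _ (Function.invFunOn_mem hmem) p hp
    rw [Function.invFunOn_eq hmem, sub_self, norm_zero, mul_zero, sub_zero] at h1
    exact sub_eq_zero.1 (norm_le_zero_iff.1 h1)
  refine ⟨F ∘ Function.invFunOn G B, ?_, ?_⟩
  · rintro _ ⟨p, hp, rfl⟩ _ ⟨q, hq, rfl⟩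
    simpa only [Function.comp_apply, hF p hp, hF q hq, ContinuousLinearMap.id_apply] using
      h p hp q hq
  · rw [Set.image_image]
    exact Set.image_congr fun p hp => hF p hp

theorem exists_pos_mul_volume_image_le (T : Type*) [Nonempty T] {m : ℝ≥0} (hm : m < 1) :
    ∃ ε : ℝ≥0, 0 < ε ∧ ∀ (B : Set T) (F G : T → V),
      (∀ p ∈ B, ∀ q ∈ B, ‖F p - F q - (G p - G q)‖ ≤ ε * ‖G p - G q‖) →
      m * volume (G '' B) ≤ volume (F '' B) := by
  obtain ⟨ε, hε, hε0⟩ := ((mul_le_addHaar_image_of_lt_det (volume : Measure V)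
    (ContinuousLinearMap.id ℝ V) (m := m) (by simpa [ContinuousLinearMap.det])
      ).and self_mem_nhdsWithin).exists
  refine ⟨ε, hε0, fun B F G h => ?_⟩
  obtain ⟨f, hf, hfB⟩ := exists_approximatesLinearOn_id h
  rw [← hfB]
  exact hε _ _ hf

theorem exists_pos_volume_image_le_mul (T : Type*) [Nonempty T] {m : ℝ≥0} (hm : 1 < m) :
    ∃ ε : ℝ≥0, 0 < ε ∧ ∀ (B : Set T) (F G : T → V),
      (∀ p ∈ B, ∀ q ∈ B, ‖F p - F q - (G p - G q)‖ ≤ ε * ‖G p - G q‖) →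
      volume (F '' B) ≤ m * volume (G '' B) := by
  obtain ⟨ε, hε, hε0⟩ := ((addHaar_image_le_mul_of_det_lt (volume : Measure V)
    (ContinuousLinearMap.id ℝ V) (m := m) (by simpa [ContinuousLinearMap.det])
      ).and self_mem_nhdsWithin).exists
  refine ⟨ε, hε0, fun B F G h => ?_⟩
  obtain ⟨f, hf, hfB⟩ := exists_approximatesLinearOn_id h
  rw [← hfB]
  exact hε _ _ hf

omit [MeasurableSpace V] [BorelSpace V] in
theorem finrank_orthogonal_singleton {k : ℕ} (hk : Module.finrank ℝ V = k + 1) {e : V}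
    (he : ‖e‖ = 1) : Module.finrank ℝ (ℝ ∙ e)ᗮ = k := by
  have he0 : e ≠ 0 := fun h => by simp [h] at he
  have h1 := (ℝ ∙ e).finrank_add_finrank_orthogonal
  rw [finrank_span_singleton he0] at h1
  omega

namespace IsSmoothConvexBody

variable {K : Set V} {ν : V → V} {L : ℝ} (hK : IsSmoothConvexBody K ν L)
include hK

theorem isFiniteMeasure_boundary {k : ℕ} (hk : Module.finrank ℝ V = k + 1) :
    IsFiniteMeasure (μHE[k] : Measure (frontier K)) := by
  have hcomp : CompactSpace (frontier K) :=
    isCompact_iff_compactSpace.1 hK.isCompact.isCompact_frontier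
  refine ⟨isCompact_univ.measure_lt_top_of_nhdsWithin fun x₀ _ => ?_⟩
  obtain ⟨r, hr, h⟩ := hK.exists_chart (c := 1) (δ := 1) (t := 1 / 2) (ε := 1) (s := 0) one_pos
    one_pos (fun x y _ => by simp [tubeMap, Subtype.dist_eq]) x₀ (by norm_num) (by norm_num) one_pos
  refine ⟨closedBall x₀ r, mem_nhdsWithin_of_mem_nhds (closedBall_mem_nhds x₀ hr), ?_⟩
  set g : frontier K → (ℝ ∙ ν x₀)ᗮ :=
    fun x => (ℝ ∙ ν x₀)ᗮ.orthogonalProjectionOnto (tubeMap K ν (x, 0))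
  have hg : Continuous g := ((ℝ ∙ ν x₀)ᗮ.orthogonalProjectionOnto.continuous).comp
    (hK.continuous_tubeMap.comp (by fun_prop))
  have h1 := euclideanHausdorffMeasure_le_mul_image (C := 2) (f := g) (s := closedBall x₀ r)
    (fun x hx y hy => by
      have := (h x y hx hy).1
      push_cast
      linarith) k
  refine h1.trans_lt (ENNReal.mul_lt_top (by simp) ?_)
  rw [← finrank_orthogonal_singleton hk (hK.norm_eq_one _ x₀.2),
    InnerProductSpace.euclideanHausdorffMeasure_eq_volume]
  exact (isClosed_closedBall.isCompact.image hg).measure_lt_top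

variable {k : ℕ} [SFinite (μHE[k] : Measure (frontier K))] (hk : Module.finrank ℝ V = k + 1)
  {c δ s : ℝ} (hc : 0 < c) (hδ : 0 < δ)
  (hlow : ∀ x y : frontier K, dist x y ≤ δ →
      c * dist x y ≤ dist (tubeMap K ν (x, s)) (tubeMap K ν (y, s)))
include hk hc hδ hlow

theorem exists_nhds_mul_le_volume_image (x₀ : frontier K) {a : ℝ≥0} (ha : a < c ^ k) :
    ∃ N ∈ 𝓝 (x₀, s), ∀ B ⊆ N, MeasurableSet B →
      a * ((μHE[k] : Measure (frontier K)).prod volume) B ≤ volume (tubeMap K ν '' B) := by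
  have hcomp : CompactSpace (frontier K) :=
    isCompact_iff_compactSpace.1 hK.isCompact.isCompact_frontier
  obtain ⟨t, hta, ht0, ht1⟩ : ∃ t : ℝ, (a : ℝ) < t * (t * c) ^ k ∧ 0 < t ∧ t < 1 := by
    have h1 : ∀ᶠ t in 𝓝[<] (1 : ℝ), (a : ℝ) < t * (t * c) ^ k :=
      nhdsWithin_le_nhds ((by fun_prop : ContinuousAt (fun t : ℝ => t * (t * c) ^ k) 1
        ).eventually_const_lt (by simpa))
    have h2 : ∀ᶠ t in 𝓝[<] (1 : ℝ), 0 < t :=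
      nhdsWithin_le_nhds (eventually_gt_nhds one_pos)
    obtain ⟨t, h, h'⟩ := ((h1.and h2).and self_mem_nhdsWithin).exists
    exact ⟨t, h.1, h.2, h'⟩
  have : Nonempty (frontier K × ℝ) := ⟨(x₀, s)⟩
  let t' : ℝ≥0 := ⟨t, ht0.le⟩
  obtain ⟨ε, hε0, hε⟩ := exists_pos_mul_volume_image_le (V := V) (frontier K × ℝ)
    (m := t') ht1
  obtain ⟨r, hr, h⟩ := hK.exists_chart hc hδ hlow x₀ ht0 ht1 (ε := ε) hε0
  refine ⟨closedBall x₀ r ×ˢ closedBall s r,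
    prod_mem_nhds (closedBall_mem_nhds _ hr) (closedBall_mem_nhds _ hr), fun B hBN hB => ?_⟩
  set g : frontier K → (ℝ ∙ ν x₀)ᗮ :=
    fun x => (ℝ ∙ ν x₀)ᗮ.orthogonalProjectionOnto (tubeMap K ν (x, s)) with hgdef
  have hg : Continuous g := ((ℝ ∙ ν x₀)ᗮ.orthogonalProjectionOnto.continuous).comp
    (hK.continuous_tubeMap.comp (by fun_prop))
  have htc : 0 < t * c := by positivity
  have h1 := le_mul_volume_image_graph (C := ⟨(t * c)⁻¹, by positivity⟩) (N := closedBall x₀ r)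
    (finrank_orthogonal_singleton hk (hK.norm_eq_one _ x₀.2)) (hK.norm_eq_one _ x₀.2) hg
    (fun x hx y hy => by
      have := (h x y hx hy).1
      change _ ≤ (t * c)⁻¹ * _
      rw [inv_mul_eq_div, le_div_iff₀ htc]
      linarith) hB (fun p hp => (hBN hp).1)
  have h2 := hε B (tubeMap K ν) (fun p => (g p.1 : V) + p.2 • ν x₀) fun p hp q hq =>
    (h p.1 q.1 (hBN hp).1 (hBN hq).1).2 p.2 q.2 (hBN hp).2 (hBN hq).2
  set G := (fun p : frontier K × ℝ => (g p.1 : V) + p.2 • ν x₀) '' B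
  set c' : ℝ≥0 := ⟨t * c, htc.le⟩ with hc'
  have hc'0 : c' ≠ 0 := fun h => htc.ne' (congrArg NNReal.toReal h)
  have hinv : (⟨(t * c)⁻¹, by positivity⟩ : ℝ≥0) = c'⁻¹ := rfl
  rw [hinv] at h1
  have hac : a ≤ t' * c' ^ k := by
    rw [← NNReal.coe_le_coe]; push_cast; exact hta.le
  have hcc : c' ^ k * c'⁻¹ ^ k = 1 := by rw [← mul_pow, mul_inv_cancel₀ hc'0, one_pow]
  calc _ ≤ ((t' * c' ^ k : ℝ≥0) : ℝ≥0∞) *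
        ((μHE[k] : Measure (frontier K)).prod volume) B := by gcongr
    _ ≤ ((t' * c' ^ k : ℝ≥0) : ℝ≥0∞) * ((c'⁻¹ : ℝ≥0) ^ k * volume G) := by gcongr
    _ = t' * volume G := by
        rw [← ENNReal.coe_pow, ← mul_assoc, ← ENNReal.coe_mul, mul_assoc, hcc, mul_one]
    _ ≤ _ := h2

theorem exists_nhds_volume_image_le_mul (x₀ : frontier K) {C a : ℝ≥0} (ha : C ^ k < a)
    (hup : ∀ x y : frontier K, dist x y ≤ δ →
      dist (tubeMap K ν (x, s)) (tubeMap K ν (y, s)) ≤ C * dist x y) :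
    ∃ N ∈ 𝓝 (x₀, s), ∀ B ⊆ N, MeasurableSet B →
      volume (tubeMap K ν '' B) ≤ a * ((μHE[k] : Measure (frontier K)).prod volume) B := by
  have hcomp : CompactSpace (frontier K) :=
    isCompact_iff_compactSpace.1 hK.isCompact.isCompact_frontier
  obtain ⟨t, hta, ht1⟩ : ∃ t : ℝ≥0, t * C ^ k < a ∧ 1 < t := by
    have h1 : ∀ᶠ t in 𝓝[>] (1 : ℝ≥0), t * C ^ k < a :=
      nhdsWithin_le_nhds ((by fun_prop : ContinuousAt (fun t : ℝ≥0 => t * C ^ k) 1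
        ).eventually_lt_const (by simpa))
    exact (h1.and self_mem_nhdsWithin).exists
  have : Nonempty (frontier K × ℝ) := ⟨(x₀, s)⟩
  obtain ⟨ε, hε0, hε⟩ := exists_pos_volume_image_le_mul (V := V) (frontier K × ℝ) ht1
  obtain ⟨r, hr, h⟩ := hK.exists_chart hc hδ hlow x₀ (t := 1 / 2) (by norm_num) (by norm_num)
    (ε := ε) hε0
  have hmin : 0 < min r (δ / 2) := by positivity
  refine ⟨closedBall x₀ (min r (δ / 2)) ×ˢ closedBall s r,
    prod_mem_nhds (closedBall_mem_nhds _ hmin) (closedBall_mem_nhds _ hr), fun B hBN hB => ?_⟩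
  set g : frontier K → (ℝ ∙ ν x₀)ᗮ :=
    fun x => (ℝ ∙ ν x₀)ᗮ.orthogonalProjectionOnto (tubeMap K ν (x, s)) with hgdef
  have hg : Continuous g := ((ℝ ∙ ν x₀)ᗮ.orthogonalProjectionOnto.continuous).comp
    (hK.continuous_tubeMap.comp (by fun_prop))
  have hr' : ∀ x ∈ closedBall x₀ (min r (δ / 2)), dist x x₀ ≤ r := fun x hx =>
    (mem_closedBall.1 hx).trans (min_le_left _ _)
  have hinj : Set.InjOn g (closedBall x₀ (min r (δ / 2))) := fun x hx y hy hxy => by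
    have h1 := (h x y (hr' x hx) (hr' y hy)).1
    have h2 : dist (g x) (g y) = 0 := by rw [hxy, dist_self]
    have h3 : 1 / 2 * c * dist x y ≤ 0 := h1.trans_eq h2
    exact dist_le_zero.1 (nonpos_of_mul_nonpos_right h3 (by positivity))
  have hlip : LipschitzOnWith C g (closedBall x₀ (min r (δ / 2))) :=
    LipschitzOnWith.of_dist_le_mul fun x hx y hy => by
      have hxy : dist x y ≤ δ := by
        have h1 := (mem_closedBall.1 hx).trans (min_le_right _ _)
        have h2 := (mem_closedBall.1 hy).trans (min_le_right _ _)
        linarith [dist_triangle_right x y x₀]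
      refine le_trans ?_ (hup x y hxy)
      simpa using ((ℝ ∙ ν x₀)ᗮ.lipschitzWith_orthogonalProjectionOnto).dist_le_mul
        (tubeMap K ν (x, s)) (tubeMap K ν (y, s))
  have h1 := volume_image_graph_le (finrank_orthogonal_singleton hk (hK.norm_eq_one _ x₀.2))
    (hK.norm_eq_one _ x₀.2) hg hinj hlip hB (fun p hp => (hBN hp).1)
  have h2 := hε B (tubeMap K ν) (fun p => (g p.1 : V) + p.2 • ν x₀) fun p hp q hq =>
    (h p.1 q.1 (hr' _ (hBN hp).1) (hr' _ (hBN hq).1)).2 p.2 q.2 (hBN hp).2 (hBN hq).2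
  refine h2.trans ?_
  calc _ ≤ (t : ℝ≥0∞) * (C ^ k * ((μHE[k] : Measure (frontier K)).prod volume) B) := by gcongr
    _ = ((t * C ^ k : ℝ≥0) : ℝ≥0∞) * ((μHE[k] : Measure (frontier K)).prod volume) B := by
        push_cast; ring
    _ ≤ _ := by gcongr

end IsSmoothConvexBody

end LocalComparison

section Gluing

open scoped Topology

variable {Z : Type*} [TopologicalSpace Z] [SecondCountableTopology Z] [MeasurableSpace Z]
  [OpensMeasurableSpace Z]

theorem le_of_locally_le {D : Set Z} {φ₁ φ₂ : Set Z → ℝ≥0∞} (h₀ : φ₁ ∅ = 0)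
    (h₁ : ∀ B : ℕ → Set Z, (∀ i, MeasurableSet (B i)) → (∀ i, B i ⊆ D) →
      Pairwise (Function.onFun Disjoint B) → φ₁ (⋃ i, B i) = ∑' i, φ₁ (B i))
    (h₂ : ∀ B : ℕ → Set Z, (∀ i, MeasurableSet (B i)) → (∀ i, B i ⊆ D) →
      Pairwise (Function.onFun Disjoint B) → φ₂ (⋃ i, B i) = ∑' i, φ₂ (B i))
    (h : ∀ p ∈ D, ∃ N ∈ 𝓝 p, ∀ B ⊆ N, MeasurableSet B → B ⊆ D → φ₁ B ≤ φ₂ B)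
    {B : Set Z} (hB : MeasurableSet B) (hBD : B ⊆ D) : φ₁ B ≤ φ₂ B := by
  rcases B.eq_empty_or_nonempty with rfl | hne
  · simp [h₀]
  choose! N hN hNle using h
  obtain ⟨t, htB, htc, hcover⟩ := TopologicalSpace.countable_cover_nhdsWithin
    (f := fun p => interior (N p)) (s := B)
    fun p hp => mem_nhdsWithin_of_mem_nhds (interior_mem_nhds.2 (hN p (hBD hp)))
  have htne : t.Nonempty := by
    obtain ⟨p, hp⟩ := hne
    obtain ⟨q, hq, -⟩ := Set.mem_iUnion₂.1 (hcover hp)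
    exact ⟨q, hq⟩
  obtain ⟨g, rfl⟩ := htc.exists_eq_range htne
  set O : ℕ → Set Z := fun i => B ∩ disjointed (fun i => interior (N (g i))) i
  have hOm : ∀ i, MeasurableSet (O i) := fun i =>
    hB.inter (MeasurableSet.disjointed (fun i => isOpen_interior.measurableSet) i)
  have hOB : ∀ i, O i ⊆ B := fun i => Set.inter_subset_left
  have hOd : Pairwise (Function.onFun Disjoint O) := fun i j hij =>
    (disjoint_disjointed (fun i => interior (N (g i))) hij).mono Set.inter_subset_right
      Set.inter_subset_right
  have hOU : ⋃ i, O i = B := by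
    rw [← Set.inter_iUnion, iUnion_disjointed]
    exact Set.inter_eq_left.2 (by simpa using hcover)
  rw [← hOU, h₁ O hOm (fun i => (hOB i).trans hBD) hOd, h₂ O hOm (fun i => (hOB i).trans hBD) hOd]
  refine ENNReal.tsum_le_tsum fun i => hNle _ (hBD (htB ⟨i, rfl⟩)) _ ?_ (hOm i)
    ((hOB i).trans hBD)
  exact Set.inter_subset_right.trans ((disjointed_subset _ _).trans interior_subset)

theorem measure_image_iUnion_of_injOn {Y V : Type*} [TopologicalSpace Y] [PolishSpace Y]
    [MeasurableSpace Y] [BorelSpace Y]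
    [TopologicalSpace V] [T2Space V] [SecondCountableTopology V] [MeasurableSpace V] [BorelSpace V]
    {μ : Measure V} {T : Y → V} (hT : Continuous T) {D : Set Y} (hinj : Set.InjOn T D)
    {B : ℕ → Set Y} (hB : ∀ i, MeasurableSet (B i)) (hBD : ∀ i, B i ⊆ D)
    (hd : Pairwise (Function.onFun Disjoint B)) :
    μ (T '' ⋃ i, B i) = ∑' i, μ (T '' B i) := by
  rw [Set.image_iUnion]
  refine measure_iUnion (fun i j hij => ?_)
    fun i => (hB i).image_of_continuousOn_injOn hT.continuousOn (hinj.mono (hBD i))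
  refine Set.disjoint_left.2 ?_
  rintro _ ⟨p, hp, rfl⟩ ⟨q, hq, hqp⟩
  rw [hinj (hBD j hq) (hBD i hp) hqp] at hq
  exact Set.disjoint_left.1 (hd hij) hp hq

end Gluing

section TubeVolume

open scoped NNReal Topology

variable {V : Type*} [NormedAddCommGroup V] [InnerProductSpace ℝ V] {K : Set V} {ν : V → V}
  {L : ℝ}

theorem tubeMap_sub_tubeMap (x y : frontier K) (s : ℝ) :
    tubeMap K ν (x, s) - tubeMap K ν (y, s) = ((x : V) - y) + s • (ν x - ν y) := by
  simp only [tubeMap]; module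

theorem norm_tubeMap_sub_sq (x y : frontier K) (s : ℝ) :
    ‖tubeMap K ν (x, s) - tubeMap K ν (y, s)‖ ^ 2 =
      ‖(x : V) - y‖ ^ 2 + 2 * s * ⟪(x : V) - y, ν x - ν y⟫ + s ^ 2 * ‖ν x - ν y‖ ^ 2 := by
  rw [tubeMap_sub_tubeMap, norm_add_sq_real, inner_smul_right, norm_smul, mul_pow,
    Real.norm_eq_abs, sq_abs]
  ring

theorem IsSmoothConvexBody.dist_tubeMap_le (hK : IsSmoothConvexBody K ν L) (x y : frontier K)
    (s : ℝ) : dist (tubeMap K ν (x, s)) (tubeMap K ν (y, s)) ≤ (1 + L * |s|) * dist x y := by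
  rw [dist_eq_norm, tubeMap_sub_tubeMap, Subtype.dist_eq, dist_eq_norm]
  refine (norm_add_le _ _).trans ?_
  rw [norm_smul, Real.norm_eq_abs]
  nlinarith [mul_le_mul_of_nonneg_left (hK.lipschitz _ x.2 _ y.2) (abs_nonneg s)]

theorem IsSmoothConvexBody.mul_dist_le_dist_tubeMap (hK : IsSmoothConvexBody K ν L)
    (x y : frontier K) (s : ℝ) :
    (1 - L * |s|) * dist x y ≤ dist (tubeMap K ν (x, s)) (tubeMap K ν (y, s)) := by
  rw [dist_eq_norm, tubeMap_sub_tubeMap, Subtype.dist_eq, dist_eq_norm]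
  have h1 : ‖(x : V) - y‖ ≤ ‖((x : V) - y) + s • (ν x - ν y)‖ + ‖s • (ν x - ν y)‖ := by
    calc ‖(x : V) - y‖ = ‖((x : V) - y) + s • (ν x - ν y) - s • (ν x - ν y)‖ := by simp
      _ ≤ _ := norm_sub_le _ _
  rw [norm_smul, Real.norm_eq_abs] at h1
  nlinarith [mul_le_mul_of_nonneg_left (hK.lipschitz _ x.2 _ y.2) (abs_nonneg s)]

namespace IsUniformlyConvexBody

variable {β δ : ℝ} (hK : IsUniformlyConvexBody K ν L β δ)
include hK

theorem mul_dist_le_dist_tubeMap {x y : frontier K} {s : ℝ} (hs : 0 ≤ s) (hxy : dist x y ≤ δ) :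
    (1 + β * s) * dist x y ≤ dist (tubeMap K ν (x, s)) (tubeMap K ν (y, s)) := by
  have hβ := hK.β_pos
  rw [dist_eq_norm (tubeMap K ν _), Subtype.dist_eq, dist_eq_norm]
  rw [Subtype.dist_eq, dist_eq_norm] at hxy
  have h1 := hK.mul_sq_le_inner_sub x.2 y.2 hxy
  have h2 : β * ‖(x : V) - y‖ ≤ ‖ν x - ν y‖ := by
    rcases (norm_nonneg ((x : V) - y)).eq_or_lt with h0 | h0
    · rw [← h0]; simp
    · have := h1.trans (real_inner_le_norm _ _)
      nlinarith
  refine (pow_le_pow_iff_left₀ (by positivity) (norm_nonneg _) two_ne_zero).1 ?_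
  rw [norm_tubeMap_sub_sq]
  have h3 := pow_le_pow_left₀ (by positivity) h2 2
  nlinarith [mul_le_mul_of_nonneg_left h1 hs, mul_le_mul_of_nonneg_left h3 (sq_nonneg s)]

theorem dist_tubeMap_le_mul {β' : ℝ} {x y : frontier K} {s : ℝ} (hs : s ≤ 0)
    (hxy : dist x y ≤ δ) (hsL : L ^ 2 * -s ≤ 2 * (β - β')) (hsβ : 0 ≤ 1 + β' * s) :
    dist (tubeMap K ν (x, s)) (tubeMap K ν (y, s)) ≤ (1 + β' * s) * dist x y := by
  rw [dist_eq_norm (tubeMap K ν _), Subtype.dist_eq, dist_eq_norm]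
  rw [Subtype.dist_eq, dist_eq_norm] at hxy
  have h1 := hK.mul_sq_le_inner_sub x.2 y.2 hxy
  have h2 := pow_le_pow_left₀ (norm_nonneg _) (hK.lipschitz _ x.2 _ y.2) 2
  refine (pow_le_pow_iff_left₀ (norm_nonneg _) (by positivity) two_ne_zero).1 ?_
  rw [norm_tubeMap_sub_sq]
  have h3 := mul_le_mul_of_nonneg_left hsL (mul_nonneg (neg_nonneg.2 hs)
    (sq_nonneg ‖(x : V) - y‖))
  nlinarith [mul_le_mul_of_nonneg_left h1 (neg_nonneg.2 hs),
    mul_le_mul_of_nonneg_left h2 (sq_nonneg s), sq_nonneg (β' * s * ‖(x : V) - y‖)]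

end IsUniformlyConvexBody

theorem one_sub_mul_pow_lt {k : ℕ} (hk : k ≠ 0) {a b s : ℝ} (ha : 0 < a) (hab : a < b) (hs : 0 < s)
    (hbs : b * s ≤ 1) (hsmall : k * a * b * s < b - a) : (1 - b * s) ^ k < 1 - k * a * s := by
  have hk0 : (0 : ℝ) < k := by positivity
  have hb : 0 < b := ha.trans hab
  have h1 : 1 + k * (b * s) ≤ (1 + b * s) ^ k :=
    one_add_mul_le_pow (by nlinarith [mul_pos hb hs]) k
  have h2 : (1 - b * s) ^ k * (1 + b * s) ^ k ≤ 1 := by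
    rw [← mul_pow]
    exact pow_le_one₀ (mul_nonneg (by linarith) (by positivity)) (by nlinarith [sq_nonneg (b * s)])
  have h0 : 0 ≤ (1 - b * s) ^ k := pow_nonneg (by linarith) k
  have h3 : (1 - b * s) ^ k * (1 + k * (b * s)) ≤ 1 :=
    (mul_le_mul_of_nonneg_left h1 h0).trans h2
  have h4 : 1 < (1 - k * a * s) * (1 + k * (b * s)) := by
    nlinarith [mul_pos (mul_pos hk0 hs) (sub_pos.2 hsmall)]
  by_contra! h5
  nlinarith [mul_le_mul_of_nonneg_right h5 (by positivity : (0 : ℝ) ≤ 1 + k * (b * s))]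

end TubeVolume

section TubeVolumeComparison

open scoped NNReal Topology

variable {V : Type*} [NormedAddCommGroup V] [InnerProductSpace ℝ V] [FiniteDimensional ℝ V]
  [MeasurableSpace V] [BorelSpace V] {K : Set V} {ν : V → V} {L β δ : ℝ}
  (hK : IsUniformlyConvexBody K ν L β δ) {k : ℕ} [IsFiniteMeasure (μHE[k] : Measure (frontier K))]

namespace IsUniformlyConvexBody

include hK

omit [FiniteDimensional ℝ V] [MeasurableSpace V] [BorelSpace V] in
theorem exists_injOn_tubeMap : ∃ κ > 0, Set.InjOn (tubeMap K ν) {p | -κ < p.2} := by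
  obtain ⟨κ, hκ0, hκ⟩ := hK.exists_mul_sq_norm_sub_le_inner
  refine ⟨κ, hκ0, fun p hp q hq hpq => ?_⟩
  obtain ⟨h1, h2⟩ := hK.injOn_tube hκ0 hκ p.1.2 q.1.2 hp hq hpq
  exact Prod.ext (Subtype.ext h1) h2

variable (hk : Module.finrank ℝ V = k + 1) {κ : ℝ}
  (hinj : Set.InjOn (tubeMap K ν) {p | -κ < p.2})
include hk hinj

theorem lintegral_le_volume_image (hκ : 0 < κ) (hk0 : k ≠ 0) {b : ℝ} (hb : 0 < b) (hbβ : b < β)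
    {B : Set (frontier K × ℝ)} (hB : MeasurableSet B) (hBpos : B ⊆ {p | 0 < p.2}) :
    ∫⁻ p in B, ENNReal.ofReal (1 + k * b * p.2) ∂((μHE[k] : Measure (frontier K)).prod volume) ≤
      volume (tubeMap K ν '' B) := by
  have hcomp : CompactSpace (frontier K) :=
    isCompact_iff_compactSpace.1 hK.isCompact.isCompact_frontier
  have hk1 : (0 : ℝ) < k := by positivity
  refine le_of_locally_le (φ₁ := fun B => ∫⁻ p in B, ENNReal.ofReal (1 + k * b * p.2)
    ∂((μHE[k] : Measure (frontier K)).prod volume)) (φ₂ := fun B => volume (tubeMap K ν '' B))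
    (D := {p | 0 < p.2}) (by simp) (fun B hB _ hd => lintegral_iUnion hB hd _)
    (fun B hB hBD hd => measure_image_iUnion_of_injOn hK.continuous_tubeMap
      (hinj.mono fun p hp => (neg_neg_of_pos hκ).trans hp) hB hBD hd) ?_ hB hBpos
  rintro ⟨x, s⟩ hs
  have hs : 0 < s := hs
  have hlt : 1 + k * b * s < (1 + β * s) ^ k := by
    have h1 := one_add_mul_le_pow (a := β * s) (by nlinarith [mul_pos (hb.trans hbβ) hs]) k
    nlinarith [mul_pos hk1 (mul_pos (sub_pos.2 hbβ) hs)]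
  obtain ⟨a, ha1, ha2⟩ := exists_between hlt
  lift a to ℝ≥0 using by linarith [mul_pos (mul_pos hk1 hb) hs]
  have hβ := hK.β_pos
  obtain ⟨N, hN, hNle⟩ := hK.exists_nhds_mul_le_volume_image hk (c := 1 + β * s) (by positivity)
    hK.δ_pos (fun x y hxy => hK.mul_dist_le_dist_tubeMap hs.le hxy) x (a := a)
    (by exact_mod_cast ha2)
  have hN2 : {p : frontier K × ℝ | 1 + k * b * p.2 < a} ∈ 𝓝 (x, s) :=
    (by fun_prop : ContinuousAt (fun p : frontier K × ℝ => 1 + k * b * p.2) (x, s)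
      ).eventually_lt_const ha1
  refine ⟨_, Filter.inter_mem hN hN2, fun B hBN hB _ => ?_⟩
  refine le_trans ?_ (hNle B (fun p hp => (hBN hp).1) hB)
  rw [← setLIntegral_const]
  refine setLIntegral_mono' hB fun p hp => ?_
  rw [← ENNReal.ofReal_coe_nnreal]
  exact ENNReal.ofReal_le_ofReal (hBN hp).2.le

theorem exists_volume_image_le_lintegral (hκ : 0 < κ) (hk0 : k ≠ 0) {b : ℝ} (hb : 0 < b)
    (hbβ : b < β) : ∃ τ > 0, ∀ B : Set (frontier K × ℝ), MeasurableSet B →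
      B ⊆ {p | -τ < p.2 ∧ p.2 < 0} → volume (tubeMap K ν '' B) ≤
        ∫⁻ p in B, ENNReal.ofReal (1 + k * b * p.2)
          ∂((μHE[k] : Measure (frontier K)).prod volume) := by
  have hcomp : CompactSpace (frontier K) :=
    isCompact_iff_compactSpace.1 hK.isCompact.isCompact_frontier
  have hL := hK.L_nonneg
  obtain ⟨b', hbb', hb'β⟩ := exists_between hbβ
  have hb' : 0 < b' := hb.trans hbb'
  obtain ⟨τ, ⟨hτκ, hτb, hτL, hτsmall, hτL1⟩, hτ⟩ : ∃ τ : ℝ, (τ < κ ∧ b' * τ < 1 ∧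
      L ^ 2 * τ < 2 * (β - b') ∧ k * b * b' * τ < b' - b ∧ L * τ < 1) ∧ 0 < τ := by
    have hev : ∀ (A : ℝ) {C : ℝ}, 0 < C → ∀ᶠ τ in 𝓝[>] (0 : ℝ), A * τ < C := fun A C hC =>
      nhdsWithin_le_nhds ((by fun_prop : ContinuousAt (fun τ : ℝ => A * τ) 0
        ).eventually_lt_const (by simpa))
    have h := (hev 1 hκ).and ((hev b' one_pos).and ((hev (L ^ 2) (C := 2 * (β - b'))
      (by linarith)).and ((hev (k * b * b') (sub_pos.2 hbb')).and (hev L one_pos))))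
    simp only [one_mul] at h
    exact (h.and self_mem_nhdsWithin).exists
  refine ⟨τ, hτ, fun B hB hBτ => ?_⟩
  refine le_of_locally_le (φ₂ := fun B => ∫⁻ p in B, ENNReal.ofReal (1 + k * b * p.2)
    ∂((μHE[k] : Measure (frontier K)).prod volume)) (φ₁ := fun B => volume (tubeMap K ν '' B))
    (D := {p | -τ < p.2 ∧ p.2 < 0}) (by simp)
    (fun B hB hBD hd => measure_image_iUnion_of_injOn hK.continuous_tubeMap
      (hinj.mono fun p hp => (neg_lt_neg hτκ).trans hp.1) hB hBD hd)
    (fun B hB _ hd => lintegral_iUnion hB hd _) ?_ hB hBτ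
  rintro ⟨x, s⟩ ⟨hs1, hs2⟩
  have hs1 : -τ < s := hs1
  have hs2 : s < 0 := hs2
  have hsτ : -s ≤ τ := by linarith
  have hmul : ∀ A : ℝ, 0 ≤ A → A * -s ≤ A * τ := fun A hA => mul_le_mul_of_nonneg_left hsτ hA
  have hCb : 0 ≤ 1 + b' * s := by linarith [hmul b' hb'.le]
  have hlt : (1 + b' * s) ^ k < 1 + k * b * s := by
    have h := one_sub_mul_pow_lt hk0 hb hbb' (neg_pos.2 hs2) (by linarith [hmul b' hb'.le])
      (by linarith [hmul (k * b * b') (by positivity)])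
    simpa using h
  obtain ⟨a, ha1, ha2⟩ := exists_between hlt
  lift a to ℝ≥0 using (pow_nonneg hCb k).trans ha1.le
  obtain ⟨C, hC⟩ : ∃ C : ℝ≥0, (C : ℝ) = 1 + b' * s := ⟨⟨_, hCb⟩, rfl⟩
  rw [← hC] at ha1
  obtain ⟨N, hN, hNle⟩ := hK.exists_nhds_volume_image_le_mul hk (s := s) (c := 1 - L * |s|)
    (by rw [abs_of_neg hs2]; linarith [hmul L hL])
    hK.δ_pos (fun x y _ => hK.toIsSmoothConvexBody.mul_dist_le_dist_tubeMap x y s) x (C := C)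
    (a := a) (by exact_mod_cast ha1)
    (fun x y hxy => hC ▸ hK.dist_tubeMap_le_mul hs2.le hxy
      (by linarith [hmul (L ^ 2) (sq_nonneg L)])
      hCb)
  have hN2 : {p : frontier K × ℝ | a < 1 + k * b * p.2} ∈ 𝓝 (x, s) :=
    (by fun_prop : ContinuousAt (fun p : frontier K × ℝ => 1 + k * b * p.2) (x, s)
      ).eventually_const_lt ha2
  refine ⟨_, Filter.inter_mem hN hN2, fun B hBN hB _ => ?_⟩
  refine (hNle B (fun p hp => (hBN hp).1) hB).trans ?_
  rw [← setLIntegral_const]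
  refine setLIntegral_mono' hB fun p hp => ?_
  rw [← ENNReal.ofReal_coe_nnreal]
  exact ENNReal.ofReal_le_ofReal (hBN hp).2.le

theorem exists_volume_image_le_mul (hκ : 0 < κ) {a : ℝ≥0} (ha : 1 < a) :
    ∃ τ > 0, ∀ B : Set (frontier K × ℝ), MeasurableSet B →
      B ⊆ {p | 0 < p.2 ∧ p.2 < τ} → volume (tubeMap K ν '' B) ≤
        a * ((μHE[k] : Measure (frontier K)).prod volume) B := by
  have hcomp : CompactSpace (frontier K) :=
    isCompact_iff_compactSpace.1 hK.isCompact.isCompact_frontier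
  have hL := hK.L_nonneg
  obtain ⟨τ, ⟨hτa, hτL⟩, hτ⟩ : ∃ τ : ℝ, ((1 + L * τ) ^ k < a ∧ L * τ < 1) ∧ 0 < τ := by
    have h1 : ∀ᶠ τ in 𝓝[>] (0 : ℝ), (1 + L * τ) ^ k < a :=
      nhdsWithin_le_nhds ((by fun_prop : ContinuousAt (fun τ : ℝ => (1 + L * τ) ^ k) 0
        ).eventually_lt_const (by simpa))
    have h2 : ∀ᶠ τ in 𝓝[>] (0 : ℝ), L * τ < 1 :=
      nhdsWithin_le_nhds ((by fun_prop : ContinuousAt (fun τ : ℝ => L * τ) 0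
        ).eventually_lt_const (by simp))
    exact ((h1.and h2).and self_mem_nhdsWithin).exists
  refine ⟨τ, hτ, fun B hB hBτ => ?_⟩
  refine le_of_locally_le (φ₁ := fun B => volume (tubeMap K ν '' B))
    (φ₂ := fun B => a * ((μHE[k] : Measure (frontier K)).prod volume) B)
    (D := {p | 0 < p.2 ∧ p.2 < τ}) (by simp)
    (fun B hB hBD hd => measure_image_iUnion_of_injOn hK.continuous_tubeMap
      (hinj.mono fun p hp => (neg_neg_of_pos hκ).trans hp.1) hB hBD hd)
    (fun B hB _ hd => by rw [measure_iUnion hd hB, ENNReal.tsum_mul_left]) ?_ hB hBτ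
  rintro ⟨x, s⟩ ⟨hs1, hs2⟩
  have hs1 : 0 < s := hs1
  have hs2 : s < τ := hs2
  have hmul := mul_le_mul_of_nonneg_left hs2.le hL
  obtain ⟨C, hC⟩ : ∃ C : ℝ≥0, (C : ℝ) = 1 + L * s := ⟨⟨_, by positivity⟩, rfl⟩
  obtain ⟨N, hN, hNle⟩ := hK.exists_nhds_volume_image_le_mul hk (s := s) (c := 1 - L * |s|)
    (by rw [abs_of_pos hs1]; linarith)
    hK.δ_pos (fun x y _ => hK.toIsSmoothConvexBody.mul_dist_le_dist_tubeMap x y s) x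
    (C := C) (a := a) (by
      rw [← NNReal.coe_lt_coe]
      refine lt_of_le_of_lt ?_ hτa
      push_cast
      rw [hC]
      exact pow_le_pow_left₀ (by positivity) (by linarith) k)
    (fun x y _ => by
      have := hK.dist_tubeMap_le x y s
      rwa [abs_of_pos hs1, ← hC] at this)
  exact ⟨N, hN, fun B hBN hB _ => hNle B hBN hB⟩

theorem boundary_measure_ne_zero [Nontrivial V] (hκ : 0 < κ) :
    (μHE[k] : Measure (frontier K)) ≠ 0 := by
  intro hm
  obtain ⟨τ, hτ, hτle⟩ := hK.exists_volume_image_le_mul hk hinj hκ (a := 2) one_lt_two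
  obtain ⟨a, ha⟩ := hK.nonempty_interior
  obtain ⟨x, hx, -⟩ := hK.exists_eq_sub_smul_of_mem (interior_subset ha)
  have h1 := hτle {p | 0 < p.2 ∧ p.2 < τ} (by measurability) subset_rfl
  rw [hm, Measure.zero_prod, Measure.coe_zero, Pi.zero_apply, mul_zero] at h1
  have hsub : Kᶜ ∩ ball x τ ⊆ tubeMap K ν '' {p | 0 < p.2 ∧ p.2 < τ} := by
    rintro w ⟨hwK, hw⟩
    obtain ⟨z, hz, s, hs, rfl⟩ := hK.exists_eq_add_smul_of_notMem hwK
    refine ⟨(⟨z, hz⟩, s), ⟨hs, ?_⟩, rfl⟩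
    have h2 := hK.inner_nonpos z hz x (hK.frontier_subset hx)
    have h3 := real_inner_le_norm (z + s • ν z - x) (ν z)
    rw [hK.norm_eq_one z hz, mul_one] at h3
    have h4 : ⟪z + s • ν z - x, ν z⟫ = s - ⟪x - z, ν z⟫ := by
      rw [show z + s • ν z - x = s • ν z - (x - z) by abel, inner_sub_left, real_inner_smul_left,
        real_inner_self_eq_norm_sq, hK.norm_eq_one z hz]
      ring
    rw [mem_ball, dist_eq_norm] at hw
    change s < τ
    linarith
  have hopen : IsOpen (Kᶜ ∩ ball x τ) := hK.isCompact.isClosed.isOpen_compl.inter isOpen_ball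
  refine (hopen.measure_pos volume ⟨x + (τ / 2) • ν x, hK.add_smul_notMem hx (by positivity), ?_⟩
    ).ne' (measure_mono_null hsub (le_antisymm h1 zero_le))
  rw [mem_ball, dist_eq_norm, add_sub_cancel_left, norm_smul, hK.norm_eq_one x hx, mul_one,
    Real.norm_eq_abs, abs_of_pos (by positivity)]
  linarith

end IsUniformlyConvexBody

end TubeVolumeComparison

section Midpoint

variable {V : Type*} [NormedAddCommGroup V] [InnerProductSpace ℝ V] {K : Set V} {ν : V → V}
  {L β δ : ℝ}

/-- The open set bounded by the normal graph of `ψ` over the boundary of `K`. -/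
def normalGraphBody (K : Set V) (ν : V → V) (ψ : V → ℝ) : Set V :=
  (interior K \ tubeMap K ν '' {p | ψ p.1 < p.2 ∧ p.2 < 0}) ∪
    tubeMap K ν '' {p | 0 < p.2 ∧ p.2 < ψ p.1}

theorem IsSmoothConvexBody.closedBall_subset_or_exists [FiniteDimensional ℝ V] [Nontrivial V]
    (hK : IsSmoothConvexBody K ν L) {ψ : V → ℝ} {ρ : ℝ} (hψ : ∀ x ∈ frontier K, ψ x ≤ ρ) {a : V}
    (ha : a ∈ normalGraphBody K ν ψ) :
    closedBall a ρ ⊆ K ∨ ∃ x ∈ frontier K, ∃ u : ℝ, |u| ≤ ρ ∧ u ≤ ψ x ∧ a = x + u • ν x := by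
  rcases ha with ⟨haK, hnot⟩ | ⟨⟨x, u⟩, ⟨hu0, hu⟩, rfl⟩
  · obtain ⟨z, hz, d, hd, rfl, hball⟩ := hK.exists_eq_sub_smul_of_mem (interior_subset haK)
    rcases le_or_gt ρ d with hρ | hρ
    · exact Or.inl ((closedBall_subset_closedBall hρ).trans hball)
    · refine Or.inr ⟨z, hz, -d, by rw [abs_neg, abs_of_nonneg hd]; exact hρ.le, ?_, by module⟩
      rcases hd.eq_or_lt with rfl | hd
      · rw [zero_smul, sub_zero] at haK
        exact absurd haK hz.2
      · by_contra! h
        exact hnot ⟨(⟨z, hz⟩, -d), ⟨h, neg_neg_of_pos hd⟩, by simp [tubeMap, sub_eq_add_neg]⟩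
  · have hu0 : 0 < u := hu0
    have hu : u < ψ x := hu
    exact Or.inr ⟨x, x.2, u, by rw [abs_of_pos hu0]; exact hu.le.trans (hψ x x.2), hu.le, rfl⟩

namespace IsUniformlyConvexBody

variable (hK : IsUniformlyConvexBody K ν L β δ)
include hK

theorem inner_add_smul_sub_le {κ ε : ℝ} (hκ0 : 0 < κ)
    (hκ : ∀ x ∈ frontier K, ∀ z ∈ frontier K, κ * ‖ν x - ν z‖ ^ 2 ≤ ⟪z - x, ν z⟫) {x z : V}
    (hx : x ∈ frontier K) (hz : z ∈ frontier K) {u : ℝ} (hu : |u| ≤ 2 * ε * κ) :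
    ⟪x + u • ν x - z, ν z⟫ ≤ u - (1 - ε) * ⟪z - x, ν z⟫ := by
  have h1 : ⟪x + u • ν x - z, ν z⟫ = -⟪z - x, ν z⟫ + u * (1 - ‖ν x - ν z‖ ^ 2 / 2) := by
    rw [← inner_eq_one_sub_of_norm_eq_one (hK.norm_eq_one _ hx) (hK.norm_eq_one _ hz)]
    simp only [inner_sub_left, inner_add_left, real_inner_smul_left]
    ring
  have h2 : -u * ‖ν x - ν z‖ ^ 2 ≤ 2 * ε * κ * ‖ν x - ν z‖ ^ 2 :=
    mul_le_mul_of_nonneg_right ((neg_le_abs u).trans hu) (sq_nonneg _)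
  have hε : 0 ≤ ε := by
    by_contra! h
    nlinarith [abs_nonneg u, mul_pos (neg_pos.2 h) hκ0]
  have h3 := mul_le_mul_of_nonneg_left (hκ x hx z hz) hε
  rw [h1]
  nlinarith

theorem norm_sub_lt_of_inner_lt {η : ℝ} (hη : 0 < η) (hηδ : η ≤ δ) {x z : V}
    (hx : x ∈ K) (hz : z ∈ frontier K) (h : ⟪z - x, ν z⟫ < β / 2 * η ^ 2) : ‖x - z‖ < η := by
  have hβ := hK.β_pos
  have hδ := hK.δ_pos
  by_contra! hge
  rcases le_total ‖x - z‖ δ with h1 | h1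
  · have h2 := hK.half_mul_sq_le z hz x hx h1
    have h3 := pow_le_pow_left₀ hη.le hge 2
    nlinarith
  · have h2 := hK.mul_norm_le_inner hz hx h1
    have h3 : β * δ / 2 * δ ≤ β * δ / 2 * ‖x - z‖ := by gcongr
    have h4 := pow_le_pow_left₀ hη.le hηδ 2
    nlinarith

end IsUniformlyConvexBody

theorem neg_mul_sq_add_mul_le {c : ℝ} (hc : 0 < c) (A p : ℝ) :
    -c * p ^ 2 + A * p ≤ A ^ 2 / (4 * c) := by
  rw [le_div_iff₀ (by positivity)]
  nlinarith [sq_nonneg (2 * c * p - A)]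

variable [CompleteSpace V]

theorem exists_sub_le_of_contDiff {S : Set V} (hS : IsCompact S) {ψ : V → ℝ} (hψ : ContDiff ℝ 1 ψ)
    {ε : ℝ} (hε : 0 < ε) : ∃ M ≥ 0, ∃ η > 0, ∀ z ∈ S, ∀ x y : V, ‖x - z‖ ≤ η → ‖y - z‖ ≤ η →
      ∀ e : V, ‖e‖ = 1 → ψ x - ψ y ≤ (‖gradient ψ z - ⟪e, gradient ψ z⟫ • e‖ + ε) *
        (‖x - z‖ + ‖y - z‖) + M * |⟪x - y, e⟫| := by
  obtain ⟨η, hη, happ⟩ := exists_uniform_fderiv_approx hS isOpen_univ (Set.subset_univ S)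
    hψ.contDiffOn hε
  have hgrad : ∀ z, ‖gradient ψ z‖ = ‖fderiv ℝ ψ z‖ := fun z => by
    rw [gradient, LinearIsometryEquiv.norm_map]
  obtain ⟨M, hM⟩ := hS.exists_bound_of_continuousOn (hψ.continuous_fderiv one_ne_zero).continuousOn
  refine ⟨max M 0, le_max_right _ _, η, hη, fun z hz x y hx hy e he => ?_⟩
  have hx' := (abs_le.1 (Real.norm_eq_abs _ ▸ happ z hz x hx)).2
  have hy' := (abs_le.1 (Real.norm_eq_abs _ ▸ happ z hz y hy)).1
  set g := gradient ψ z - ⟪e, gradient ψ z⟫ • e with hg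
  have hinner : fderiv ℝ ψ z (x - z) - fderiv ℝ ψ z (y - z) =
      ⟪g, x - y⟫ + ⟪e, gradient ψ z⟫ * ⟪x - y, e⟫ := by
    have h1 : ∀ v, fderiv ℝ ψ z v = ⟪gradient ψ z, v⟫ := fun v => by
      rw [gradient, InnerProductSpace.toDual_symm_apply]
    rw [← map_sub, h1, hg, inner_sub_left, real_inner_smul_left, real_inner_comm e (x - y),
      sub_sub_sub_cancel_right]
    ring
  have h2 : ⟪g, x - y⟫ ≤ ‖g‖ * (‖x - z‖ + ‖y - z‖) := by
    refine (real_inner_le_norm _ _).trans ?_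
    gcongr
    calc ‖x - y‖ = ‖(x - z) - (y - z)‖ := by congr 1; abel
      _ ≤ _ := norm_sub_le _ _
  have h3 : ⟪e, gradient ψ z⟫ * ⟪x - y, e⟫ ≤ max M 0 * |⟪x - y, e⟫| := by
    refine (le_abs_self _).trans ?_
    rw [abs_mul]
    gcongr
    refine (abs_real_inner_le_norm _ _).trans ?_
    rw [he, one_mul, hgrad]
    exact (hM z hz).trans (le_max_left _ _)
  nlinarith

theorem IsUniformlyConvexBody.exists_midpoint_mem [FiniteDimensional ℝ V] [Nontrivial V]
    (hK : IsUniformlyConvexBody K ν L β δ) {ψ : V → ℝ} (hψ : ContDiff ℝ 1 ψ) {ε : ℝ} (hε : 0 < ε)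
    (hε1 : ε < 1) : ∃ t₀ > 0, ∀ t, 0 < t → t < t₀ → ∀ a ∈ normalGraphBody K ν fun x => t * ψ x,
      ∀ b ∈ normalGraphBody K ν fun x => -(t * ψ x),
      (2 : ℝ)⁻¹ • (a + b) ∈ K ∪ tubeMap K ν '' {p | 0 < p.2 ∧ p.2 ≤ t ^ 2 *
        ((‖gradient ψ p.1 - ⟪ν p.1, gradient ψ p.1⟫ • ν p.1‖ + 2 * ε) ^ 2 /
          (2 * ((1 - ε) * β)))} := by
  have hβ := hK.β_pos
  have hδ := hK.δ_pos
  have hL := hK.L_nonneg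
  have hS := hK.isCompact.isCompact_frontier
  obtain ⟨κ, hκ0, hκ⟩ := hK.exists_mul_sq_norm_sub_le_inner
  obtain ⟨M₁, hM₁, η₁, hη₁, happ⟩ := exists_sub_le_of_contDiff hS hψ hε
  obtain ⟨M', hM'⟩ := hS.exists_bound_of_continuousOn hψ.continuous.continuousOn
  set M := max M' 1
  have hM0 : 0 < M := lt_max_of_lt_right one_pos
  have hM : ∀ x ∈ frontier K, |ψ x| ≤ M := fun x hx => (hM' x hx).trans (le_max_left _ _)
  -- `η` is the scale on which the first order expansion is used
  obtain ⟨η, hη, hηδ, hηη₁, hηL⟩ : ∃ η > 0, η ≤ δ ∧ η ≤ η₁ ∧ M₁ * (L * η) ≤ ε := by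
    refine ⟨min (min δ η₁) (ε / (M₁ * L + 1)), by positivity,
      (min_le_left _ _).trans (min_le_left _ _), (min_le_left _ _).trans (min_le_right _ _), ?_⟩
    calc M₁ * (L * min (min δ η₁) (ε / (M₁ * L + 1))) ≤ M₁ * (L * (ε / (M₁ * L + 1))) := by
          gcongr; exact min_le_right _ _
      _ = M₁ * L * ε / (M₁ * L + 1) := by ring
      _ ≤ ε := by
          rw [div_le_iff₀ (by positivity)]
          nlinarith
  have h1ε : 0 < 1 - ε := by linarith
  set ρ := 2 * ε * κ with hρdef
  have hρ : 0 < ρ := by positivity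
  have hθ : 0 < (1 - ε) * (β / 2 * η ^ 2) := by positivity
  refine ⟨min (ρ / M) ((1 - ε) * (β / 2 * η ^ 2) / (2 * M)), by positivity,
    fun t ht htt a ha b hb => ?_⟩
  have htρ : t * M < ρ := (lt_div_iff₀ hM0).1 (htt.trans_le (min_le_left _ _))
  have htη : t * (2 * M) < (1 - ε) * (β / 2 * η ^ 2) :=
    (lt_div_iff₀ (by positivity)).1 (htt.trans_le (min_le_right _ _))
  have htψ : ∀ x ∈ frontier K, |t * ψ x| ≤ t * M := fun x hx => by
    rw [abs_mul, abs_of_pos ht]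
    exact mul_le_mul_of_nonneg_left (hM x hx) ht.le
  by_cases hmid : (2 : ℝ)⁻¹ • (a + b) ∈ K
  · exact Or.inl hmid
  right
  obtain ⟨z, hz, s, hs, hzs⟩ := hK.exists_eq_add_smul_of_notMem hmid
  have h2s : 2 * s = ⟪a - z, ν z⟫ + ⟪b - z, ν z⟫ := by
    rw [← inner_add_left, show a - z + (b - z) = (2 : ℝ) • ((2 : ℝ)⁻¹ • (a + b) - z) by module,
      hzs, add_sub_cancel_left, real_inner_smul_left, real_inner_smul_left,
      real_inner_self_eq_norm_sq, hK.norm_eq_one _ hz]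
    ring
  have key : ∀ φ : V → ℝ, (∀ x ∈ frontier K, |φ x| ≤ t * M) → ∀ w ∈ normalGraphBody K ν φ,
      ⟪w - z, ν z⟫ ≤ -ρ ∨ ∃ x ∈ frontier K, ⟪w - z, ν z⟫ ≤ φ x - (1 - ε) * ⟪z - x, ν z⟫ := by
    intro φ hφ w hw
    rcases hK.closedBall_subset_or_exists (ρ := ρ)
      (fun x hx => (le_abs_self _).trans ((hφ x hx).trans htρ.le)) hw with h | h
    · exact Or.inl (hK.inner_le_neg_of_closedBall_subset hz hρ.le h)
    · obtain ⟨x, hx, u, hu, huφ, rfl⟩ := h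
      exact Or.inr ⟨x, hx, (hK.inner_add_smul_sub_le hκ0 hκ hx hz hu).trans (by linarith)⟩
  have hD : ∀ x ∈ frontier K, 0 ≤ ⟪z - x, ν z⟫ := fun x hx =>
    hK.inner_nonneg hz (hK.frontier_subset hx)
  have hup : ∀ φ : V → ℝ, (∀ x ∈ frontier K, |φ x| ≤ t * M) → ∀ x ∈ frontier K,
      φ x - (1 - ε) * ⟪z - x, ν z⟫ ≤ t * M := fun φ hφ x hx => by
    linarith [(le_abs_self _).trans (hφ x hx), mul_nonneg h1ε.le (hD x hx)]
  have hneg : ∀ x ∈ frontier K, |(-(t * ψ x))| ≤ t * M := fun x hx => by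
    rw [abs_neg]; exact htψ x hx
  rcases key _ htψ a ha with ha1 | ⟨x, hx, ha1⟩
  · rcases key _ hneg b hb with hb1 | ⟨y, hy, hb1⟩
    · linarith
    · linarith [hup _ hneg y hy]
  rcases key _ hneg b hb with hb1 | ⟨y, hy, hb1⟩
  · linarith [hup _ htψ x hx]
  have hxψ := abs_le.1 (htψ x hx)
  have hyψ := abs_le.1 (htψ y hy)
  have hDx := hD x hx
  have hDy := hD y hy
  have hsmall : (1 - ε) * (⟪z - x, ν z⟫ + ⟪z - y, ν z⟫) < (1 - ε) * (β / 2 * η ^ 2) := by linarith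
  have hsmall' := lt_of_mul_lt_mul_left hsmall h1ε.le
  have hp := hK.norm_sub_lt_of_inner_lt hη hηδ (hK.frontier_subset hx) hz (by linarith)
  have hq := hK.norm_sub_lt_of_inner_lt hη hηδ (hK.frontier_subset hy) hz (by linarith)
  have hψxy := happ z hz x y (hp.le.trans hηη₁) (hq.le.trans hηη₁) (ν z) (hK.norm_eq_one _ hz)
  have hDp := hK.half_mul_sq_le z hz x (hK.frontier_subset hx) (hp.le.trans hηδ)
  have hDq := hK.half_mul_sq_le z hz y (hK.frontier_subset hy) (hq.le.trans hηδ)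
  have hDp' := hK.inner_le_mul_sq hz hx
  have hDq' := hK.inner_le_mul_sq hz hy
  set p := ‖x - z‖
  set q := ‖y - z‖
  have hp0 : 0 ≤ p := norm_nonneg _
  have hq0 : 0 ≤ q := norm_nonneg _
  set G := ‖gradient ψ z - ⟪ν z, gradient ψ z⟫ • ν z‖
  have hnormal : M₁ * |⟪x - y, ν z⟫| ≤ ε * (p + q) := by
    have h1 : ⟪x - y, ν z⟫ = ⟪z - y, ν z⟫ - ⟪z - x, ν z⟫ := by
      rw [← inner_sub_left]; congr 1; abel
    have h2 : |⟪x - y, ν z⟫| ≤ L * η * (p + q) := by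
      have hpp : L * p ^ 2 ≤ L * η * p := by
        rw [sq, ← mul_assoc]; gcongr
      have hqq : L * q ^ 2 ≤ L * η * q := by
        rw [sq, ← mul_assoc]; gcongr
      have hLηp : 0 ≤ L * η * p := by positivity
      have hLηq : 0 ≤ L * η * q := by positivity
      rw [h1, abs_le]
      constructor <;> linarith
    calc M₁ * |⟪x - y, ν z⟫| ≤ M₁ * (L * η * (p + q)) := by gcongr
      _ = M₁ * (L * η) * (p + q) := by ring
      _ ≤ ε * (p + q) := by gcongr
  have hψ' : ψ x - ψ y ≤ (G + 2 * ε) * (p + q) := by linarith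
  refine ⟨(⟨z, hz⟩, s), ⟨hs, ?_⟩, hzs.symm⟩
  change s ≤ t ^ 2 * ((G + 2 * ε) ^ 2 / (2 * ((1 - ε) * β)))
  set c := (1 - ε) * (β / 2) with hc
  have hc0 : 0 < c := by positivity
  have h3 := neg_mul_sq_add_mul_le hc0 (t * (G + 2 * ε)) p
  have h4 := neg_mul_sq_add_mul_le hc0 (t * (G + 2 * ε)) q
  have h5 : t * (ψ x - ψ y) ≤ t * ((G + 2 * ε) * (p + q)) := by gcongr
  have h6 := mul_le_mul_of_nonneg_left hDp h1ε.le
  have h7 := mul_le_mul_of_nonneg_left hDq h1ε.le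
  rw [← mul_assoc, ← hc] at h6 h7
  have h8 : (t * (G + 2 * ε)) ^ 2 / (4 * c) = t ^ 2 * ((G + 2 * ε) ^ 2 / (2 * ((1 - ε) * β))) := by
    rw [hc]; field_simp; ring
  rw [h8] at h3 h4
  linarith

end Midpoint

section GraphVolume

open scoped NNReal Topology

theorem lintegral_Ioo_one_add_mul {c a b : ℝ} (hab : a ≤ b) (hc : 0 ≤ c) (ha : 0 ≤ 1 + c * a) :
    ∫⁻ u in Set.Ioo a b, ENNReal.ofReal (1 + c * u) =
      ENNReal.ofReal (b - a + c * (b ^ 2 - a ^ 2) / 2) := by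
  have hintegral : IntegrableOn (fun u : ℝ => 1 + c * u) (Set.Ioo a b) :=
    ((by fun_prop : Continuous fun u : ℝ => 1 + c * u).integrableOn_Icc).mono_set
      Set.Ioo_subset_Icc_self
  rw [← ofReal_integral_eq_lintegral_ofReal hintegral
    ((ae_restrict_iff' measurableSet_Ioo).2 (.of_forall fun u hu => by
      have := mul_le_mul_of_nonneg_left hu.1.le hc
      simp only [Pi.zero_apply]
      linarith)), ← integral_Ioc_eq_integral_Ioo, ← intervalIntegral.integral_of_le hab]
  congr 1
  rw [intervalIntegral.integral_add (by simp)
    ((by fun_prop : Continuous fun u : ℝ => c * u).intervalIntegrable _ _),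
    intervalIntegral.integral_const_mul,
    integral_id]
  simp
  ring

variable {X : Type*} [TopologicalSpace X] [CompactSpace X] [MeasurableSpace X] [BorelSpace X]
  {m : Measure X} [IsFiniteMeasure m] {f : X → ℝ} {c : ℝ}

omit [CompactSpace X] in
theorem measurableSet_graph_pos (hf : Continuous f) :
    MeasurableSet {p : X × ℝ | 0 < p.2 ∧ p.2 < f p.1} :=
  (measurableSet_lt measurable_const measurable_snd).inter
    (measurableSet_lt measurable_snd (hf.measurable.comp measurable_fst))

omit [CompactSpace X] in
theorem measurableSet_graph_neg (hf : Continuous f) :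
    MeasurableSet {p : X × ℝ | f p.1 < p.2 ∧ p.2 < 0} :=
  (measurableSet_lt (hf.measurable.comp measurable_fst) measurable_snd).inter
    (measurableSet_lt measurable_snd measurable_const)

theorem integrable_of_continuous (hf : Continuous f) : Integrable f m :=
  hf.integrable_of_hasCompactSupport (HasCompactSupport.of_compactSpace f)

theorem lintegral_graph_pos (hf : Continuous f) (hc : 0 ≤ c) :
    ∫⁻ p in {p : X × ℝ | 0 < p.2 ∧ p.2 < f p.1}, ENNReal.ofReal (1 + c * p.2) ∂(m.prod volume) =
      ENNReal.ofReal (∫ x, max (f x) 0 + c * (max (f x) 0) ^ 2 / 2 ∂m) := by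
  rw [ofReal_integral_eq_lintegral_ofReal (integrable_of_continuous (by fun_prop))
    (.of_forall fun x => by simp only [Pi.zero_apply]; positivity),
    ← lintegral_indicator (measurableSet_graph_pos hf), lintegral_prod _
      (Measurable.indicator (by fun_prop) (measurableSet_graph_pos hf)).aemeasurable]
  refine lintegral_congr fun x => ?_
  have h1 : ∀ u : ℝ, {p : X × ℝ | 0 < p.2 ∧ p.2 < f p.1}.indicator
      (fun p => ENNReal.ofReal (1 + c * p.2)) (x, u) =
      (Set.Ioo 0 (max (f x) 0)).indicator (fun u => ENNReal.ofReal (1 + c * u)) u := fun u => by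
    simp only [Set.indicator, Set.mem_ofPred_eq, Set.mem_Ioo, lt_max_iff]
    congr 1
    refine propext (and_congr_right fun hu => ?_)
    simp [hu.le]
  simp only [h1]
  rw [lintegral_indicator measurableSet_Ioo, lintegral_Ioo_one_add_mul (le_max_right _ _) hc
    (by simp)]
  congr 1
  ring

theorem lintegral_graph_neg (hf : Continuous f) (hc : 0 ≤ c) (hcf : ∀ x, 0 ≤ 1 + c * f x) :
    ∫⁻ p in {p : X × ℝ | f p.1 < p.2 ∧ p.2 < 0}, ENNReal.ofReal (1 + c * p.2) ∂(m.prod volume) =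
      ENNReal.ofReal (∫ x, -min (f x) 0 - c * (min (f x) 0) ^ 2 / 2 ∂m) := by
  have hmin : ∀ x, 0 ≤ 1 + c * min (f x) 0 := fun x => by
    rcases min_choice (f x) 0 with h | h <;> rw [h]
    · exact hcf x
    · simp
  rw [ofReal_integral_eq_lintegral_ofReal (integrable_of_continuous (by fun_prop))
    (.of_forall fun x => by
      simp only [Pi.zero_apply]
      nlinarith [hmin x, min_le_right (f x) 0]),
    ← lintegral_indicator (measurableSet_graph_neg hf), lintegral_prod _
      (Measurable.indicator (by fun_prop) (measurableSet_graph_neg hf)).aemeasurable]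
  refine lintegral_congr fun x => ?_
  have h1 : ∀ u : ℝ, {p : X × ℝ | f p.1 < p.2 ∧ p.2 < 0}.indicator
      (fun p => ENNReal.ofReal (1 + c * p.2)) (x, u) =
      (Set.Ioo (min (f x) 0) 0).indicator (fun u => ENNReal.ofReal (1 + c * u)) u := fun u => by
    simp only [Set.indicator, Set.mem_ofPred_eq, Set.mem_Ioo, min_lt_iff]
    congr 1
    refine propext (and_congr_left fun hu => ?_)
    simp [hu.le]
  simp only [h1]
  rw [lintegral_indicator measurableSet_Ioo, lintegral_Ioo_one_add_mul (min_le_right _ _) hc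
    (hmin x)]
  congr 1
  ring

theorem ofReal_le_of_add_lintegral_graph_le (hf : Continuous f) (hc : 0 ≤ c)
    (hcf : ∀ x, 0 ≤ 1 + c * f x) {v : ℝ} (hv : 0 ≤ v) {A : ℝ≥0∞}
    (h : ENNReal.ofReal v + ∫⁻ p in {p : X × ℝ | 0 < p.2 ∧ p.2 < f p.1},
        ENNReal.ofReal (1 + c * p.2) ∂(m.prod volume) ≤
      A + ∫⁻ p in {p : X × ℝ | f p.1 < p.2 ∧ p.2 < 0},
        ENNReal.ofReal (1 + c * p.2) ∂(m.prod volume)) :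
    ENNReal.ofReal (v + ∫ x, f x + c * f x ^ 2 / 2 ∂m) ≤ A := by
  rw [lintegral_graph_pos hf hc, lintegral_graph_neg hf hc hcf, ← ENNReal.ofReal_add hv
    (integral_nonneg fun x => by simp only [Pi.zero_apply]; positivity), ← tsub_le_iff_right,
    ← ENNReal.ofReal_sub _ (integral_nonneg fun x => ?_)] at h
  · refine le_trans (le_of_eq ?_) h
    rw [add_sub_assoc, ← integral_sub (integrable_of_continuous (by fun_prop))
      (integrable_of_continuous (by fun_prop))]
    congr 3
    funext x
    rcases le_total (f x) 0 with h0 | h0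
    · rw [max_eq_right h0, min_eq_left h0]; ring
    · rw [max_eq_left h0, min_eq_right h0]; ring
  · simp only [Pi.zero_apply]
    rcases le_total (f x) 0 with h0 | h0
    · rw [min_eq_left h0]; nlinarith [hcf x]
    · rw [min_eq_right h0]; simp

end GraphVolume

section BodyVolume

open scoped NNReal Topology

variable {V : Type*} [NormedAddCommGroup V] [InnerProductSpace ℝ V] [FiniteDimensional ℝ V]
  [MeasurableSpace V] [BorelSpace V] {K : Set V} {ν : V → V} {L β δ : ℝ}

namespace IsUniformlyConvexBody

variable (hK : IsUniformlyConvexBody K ν L β δ) {κ : ℝ}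
  (hinj : Set.InjOn (tubeMap K ν) {p | -κ < p.2})
include hK hinj

theorem measurableSet_image_tubeMap {B : Set (frontier K × ℝ)} (hB : MeasurableSet B)
    (hBκ : B ⊆ {p | -κ < p.2}) : MeasurableSet (tubeMap K ν '' B) := by
  have hcomp : CompactSpace (frontier K) :=
    isCompact_iff_compactSpace.1 hK.isCompact.isCompact_frontier
  exact hB.image_of_continuousOn_injOn hK.continuous_tubeMap.continuousOn (hinj.mono hBκ)

theorem measurableSet_normalGraphBody (hκ : 0 < κ) {f : V → ℝ} (hf : Continuous f)
    (hfκ : ∀ x ∈ frontier K, -κ < f x) : MeasurableSet (normalGraphBody K ν f) := by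
  have hf' : Continuous fun x : frontier K => f x := hf.comp continuous_subtype_val
  exact (isOpen_interior.measurableSet.diff (hK.measurableSet_image_tubeMap hinj
    (measurableSet_graph_neg hf') fun p hp => (hfκ p.1 p.1.2).trans hp.1)).union
    (hK.measurableSet_image_tubeMap hinj (measurableSet_graph_pos hf')
      fun p hp => (neg_neg_of_pos hκ).trans hp.1)

theorem volume_add_image_pos_le (hκ : 0 < κ) {f : V → ℝ} (hf : Continuous f) :
    volume K + volume (tubeMap K ν '' {p | 0 < p.2 ∧ p.2 < f p.1}) ≤
      volume (normalGraphBody K ν f) + volume (tubeMap K ν '' {p | f p.1 < p.2 ∧ p.2 < 0}) := by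
  have hf' : Continuous fun x : frontier K => f x := hf.comp continuous_subtype_val
  have hintegral : volume (interior K) = volume K :=
    measure_congr (interior_ae_eq_of_null_frontier (hK.convex.addHaar_frontier volume))
  rw [← hintegral, normalGraphBody, measure_union ?_ (hK.measurableSet_image_tubeMap hinj
    (measurableSet_graph_pos hf') fun p hp => (neg_neg_of_pos hκ).trans hp.1)]
  · rw [add_right_comm]
    gcongr
    exact tsub_le_iff_right.1 le_measure_sdiff
  · rw [Set.disjoint_right]
    rintro _ ⟨p, hp, rfl⟩ hpK
    exact hK.add_smul_notMem p.1.2 hp.1 (interior_subset hpK.1)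

variable {k : ℕ} [IsFiniteMeasure (μHE[k] : Measure (frontier K))]
  (hk : Module.finrank ℝ V = k + 1)
include hk

theorem exists_ofReal_le_volume_normalGraphBody (hκ : 0 < κ) (hk0 : k ≠ 0) {b : ℝ} (hb : 0 < b)
    (hbβ : b < β) : ∃ τ > 0, ∀ f : V → ℝ, Continuous f → (∀ x ∈ frontier K, |f x| < τ) →
      ENNReal.ofReal ((volume K).toReal +
        ∫ x : frontier K, f x + k * b * f x ^ 2 / 2 ∂(μHE[k] : Measure (frontier K))) ≤
          volume (normalGraphBody K ν f) := by
  have hcomp : CompactSpace (frontier K) :=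
    isCompact_iff_compactSpace.1 hK.isCompact.isCompact_frontier
  obtain ⟨τ, hτ, hτle⟩ := hK.exists_volume_image_le_lintegral hk hinj hκ hk0 hb hbβ
  have hkb : 0 < (k : ℝ) * b := by positivity
  refine ⟨min τ (k * b)⁻¹, by positivity, fun f hf hfτ => ?_⟩
  have hf' : Continuous fun x : frontier K => f x := hf.comp continuous_subtype_val
  refine ofReal_le_of_add_lintegral_graph_le hf' hkb.le (fun x => ?_) ENNReal.toReal_nonneg ?_
  · have h1 := (abs_lt.1 ((hfτ x x.2).trans_le (min_le_right _ _))).1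
    have h2 := mul_le_mul_of_nonneg_left h1.le hkb.le
    rw [mul_neg, mul_inv_cancel₀ hkb.ne'] at h2
    linarith
  · rw [ENNReal.ofReal_toReal hK.isCompact.measure_lt_top.ne]
    calc _ ≤ volume K + volume (tubeMap K ν '' {p | 0 < p.2 ∧ p.2 < f p.1}) := by
          gcongr
          exact hK.lintegral_le_volume_image hk hinj hκ hk0 hb hbβ (measurableSet_graph_pos hf')
            fun p hp => hp.1
      _ ≤ _ := hK.volume_add_image_pos_le hinj hκ hf
      _ ≤ _ := by
          gcongr
          exact hτle _ (measurableSet_graph_neg hf') fun p hp =>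
            ⟨(abs_lt.1 ((hfτ p.1 p.1.2).trans_le (min_le_left _ _))).1.trans hp.1, hp.2⟩

theorem exists_volume_union_image_le (hκ : 0 < κ) {a : ℝ≥0} (ha : 1 < a) :
    ∃ τ > 0, ∀ Q : frontier K → ℝ, Continuous Q → (∀ x, 0 ≤ Q x) → (∀ x, Q x < τ) →
      MeasurableSet (K ∪ tubeMap K ν '' {p | 0 < p.2 ∧ p.2 ≤ Q p.1}) ∧
      volume (K ∪ tubeMap K ν '' {p | 0 < p.2 ∧ p.2 ≤ Q p.1}) ≤
        ENNReal.ofReal ((volume K).toReal + a * ∫ x, Q x ∂(μHE[k] : Measure (frontier K))) := by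
  have hcomp : CompactSpace (frontier K) :=
    isCompact_iff_compactSpace.1 hK.isCompact.isCompact_frontier
  obtain ⟨τ, hτ, hτle⟩ := hK.exists_volume_image_le_mul hk hinj hκ ha
  refine ⟨τ, hτ, fun Q hQ hQ0 hQτ => ?_⟩
  have hB : MeasurableSet {p : frontier K × ℝ | 0 < p.2 ∧ p.2 ≤ Q p.1} :=
    (measurableSet_lt measurable_const measurable_snd).inter
      (measurableSet_le measurable_snd (hQ.measurable.comp measurable_fst))
  refine ⟨hK.isCompact.measurableSet.union (hK.measurableSet_image_tubeMap hinj hB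
    fun p hp => (neg_neg_of_pos hκ).trans hp.1), (measure_union_le _ _).trans ?_⟩
  have hI : 0 ≤ ∫ x, Q x ∂(μHE[k] : Measure (frontier K)) := integral_nonneg hQ0
  rw [ENNReal.ofReal_add ENNReal.toReal_nonneg (by positivity),
    ENNReal.ofReal_toReal hK.isCompact.measure_lt_top.ne, ENNReal.ofReal_mul a.coe_nonneg,
    ENNReal.ofReal_coe_nnreal]
  gcongr
  refine (hτle _ hB fun p hp => ⟨hp.1, hp.2.trans_lt (hQτ p.1)⟩).trans ?_
  gcongr
  rw [Measure.prod_apply hB, ofReal_integral_eq_lintegral_ofReal (integrable_of_continuous hQ)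
    (.of_forall hQ0)]
  refine lintegral_mono fun x => ?_
  rw [show Prod.mk x ⁻¹' {p : frontier K × ℝ | 0 < p.2 ∧ p.2 ≤ Q p.1} = Set.Ioc 0 (Q x) from rfl,
    Real.volume_Ioc, sub_zero]

end IsUniformlyConvexBody

end BodyVolume

section Poincare

open scoped NNReal Topology

open Filter

namespace IsUniformlyConvexBody

variable {k : ℕ} {K : Set (EuclideanSpace ℝ (Fin (k + 1)))}
  {ν : EuclideanSpace ℝ (Fin (k + 1)) → EuclideanSpace ℝ (Fin (k + 1))} {L β δ : ℝ}
  (hK : IsUniformlyConvexBody K ν L β δ)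
  [IsFiniteMeasure (μHE[k] : Measure (frontier K))]
  {ψ : EuclideanSpace ℝ (Fin (k + 1)) → ℝ}
include hK

omit [IsFiniteMeasure (μHE[k] : Measure (frontier K))] in
theorem continuous_tangential_gradient (hψ : ContDiff ℝ 1 ψ) :
    Continuous fun x : frontier K => gradient ψ x - ⟪ν x, gradient ψ x⟫ • ν x := by
  have hν := hK.continuous_normal
  have hg : Continuous fun x : frontier K => gradient ψ x := by
    unfold gradient
    exact ((LinearIsometryEquiv.continuous _).comp (hψ.continuous_fderiv one_ne_zero)).comp
      continuous_subtype_val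
  exact hg.sub ((Continuous.inner (𝕜 := ℝ) hν hg).smul hν)

theorem mul_integral_sq_le_of_lt (hk0 : k ≠ 0) (hψ : ContDiff ℝ 1 ψ)
    (hmean : ∫ x : frontier K, ψ x ∂(μHE[k] : Measure (frontier K)) = 0) {a : ℝ≥0} (ha : 1 < a)
    {b ε : ℝ} (hb : 0 < b) (hbβ : b < β) (hε : 0 < ε) (hε1 : ε < 1) :
    k * b / 2 * ∫ x : frontier K, ψ x ^ 2 ∂(μHE[k] : Measure (frontier K)) ≤
      a * ∫ x : frontier K, (‖gradient ψ x - ⟪ν x, gradient ψ x⟫ • ν x‖ + 2 * ε) ^ 2 /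
        (2 * ((1 - ε) * β)) ∂(μHE[k] : Measure (frontier K)) := by
  have hcomp : CompactSpace (frontier K) :=
    isCompact_iff_compactSpace.1 hK.isCompact.isCompact_frontier
  have hrank : Module.finrank ℝ (EuclideanSpace ℝ (Fin (k + 1))) = k + 1 := by simp
  have hβ := hK.β_pos
  have hε' : 0 < 1 - ε := by linarith
  obtain ⟨κ, hκ, hinj⟩ := hK.exists_injOn_tubeMap
  obtain ⟨t₀, ht₀, hmid⟩ := hK.exists_midpoint_mem hψ hε hε1
  obtain ⟨τ₁, hτ₁, hlow⟩ := hK.exists_ofReal_le_volume_normalGraphBody hinj hrank hκ hk0 hb hbβ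
  obtain ⟨τ₂, hτ₂, hup⟩ := hK.exists_volume_union_image_le hinj hrank hκ ha
  obtain ⟨M, hM⟩ := hK.isCompact.isCompact_frontier.exists_bound_of_continuousOn
    hψ.continuous.continuousOn
  set Q : frontier K → ℝ := fun x =>
    (‖gradient ψ x - ⟪ν x, gradient ψ x⟫ • ν x‖ + 2 * ε) ^ 2 / (2 * ((1 - ε) * β)) with hQdef
  have hQ : Continuous Q := by
    have := hK.continuous_tangential_gradient hψ
    fun_prop
  have hQ0 : ∀ x, 0 ≤ Q x := fun x => by positivity
  obtain ⟨N, hN⟩ := isCompact_univ.exists_bound_of_continuousOn hQ.continuousOn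
  obtain ⟨t, ⟨⟨⟨htt₀, ht1⟩, htκ⟩, ht2⟩, ht⟩ : ∃ t : ℝ,
      (((t < t₀ ∧ t * M < τ₁) ∧ t * M < κ) ∧ t ^ 2 * N < τ₂) ∧ 0 < t := by
    have h0 : ∀ᶠ t in 𝓝[>] (0 : ℝ), t < t₀ := nhdsWithin_le_nhds (eventually_lt_nhds ht₀)
    have h1 : ∀ c > 0, ∀ᶠ t in 𝓝[>] (0 : ℝ), t * M < c := fun c hc =>
      nhdsWithin_le_nhds ((by fun_prop : ContinuousAt (fun t : ℝ => t * M) 0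
        ).eventually_lt_const (by simpa))
    have h2 : ∀ᶠ t in 𝓝[>] (0 : ℝ), t ^ 2 * N < τ₂ :=
      nhdsWithin_le_nhds ((by fun_prop : ContinuousAt (fun t : ℝ => t ^ 2 * N) 0
        ).eventually_lt_const (by simpa))
    exact (((((h0.and (h1 τ₁ hτ₁)).and (h1 κ hκ)).and h2)).and self_mem_nhdsWithin).exists
  have hψt : ∀ x ∈ frontier K, |t * ψ x| ≤ t * M := fun x hx => by
    rw [abs_mul, abs_of_pos ht]
    exact mul_le_mul_of_nonneg_left (hM x hx) ht.le
  have hcont : Continuous fun x => t * ψ x := continuous_const.mul hψ.continuous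
  obtain ⟨hWmeas, hW⟩ := hup (fun x => t ^ 2 * Q x) (by fun_prop)
    (fun x => mul_nonneg (sq_nonneg t) (hQ0 x))
    fun x => (mul_le_mul_of_nonneg_left ((le_abs_self _).trans (hN x trivial))
      (sq_nonneg t)).trans_lt ht2
  have hA := hlow (fun x => t * ψ x) hcont fun x hx => (hψt x hx).trans_lt ht1
  have hB := hlow (fun x => -(t * ψ x)) hcont.neg fun x hx => by
    rw [abs_neg]
    exact (hψt x hx).trans_lt ht1
  have hψ' : Continuous fun x : frontier K => ψ x := hψ.continuous.comp continuous_subtype_val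
  have hintegral : ∀ s : ℝ, s ^ 2 = t ^ 2 → ∫ x : frontier K, s * ψ x + k * b * (s * ψ x) ^ 2 / 2
      ∂(μHE[k] : Measure (frontier K)) =
        t ^ 2 * (k * b / 2 * ∫ x : frontier K, ψ x ^ 2 ∂(μHE[k] : Measure (frontier K))) := by
    intro s hs
    rw [integral_add (integrable_of_continuous (by fun_prop))
      (integrable_of_continuous (by fun_prop)), integral_const_mul, hmean, mul_zero, zero_add,
      ← integral_const_mul, ← integral_const_mul]
    refine integral_congr_ae (.of_forall fun x => ?_)
    simp only [mul_pow, hs]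
    ring
  rw [hintegral t rfl] at hA
  have hintneg := hintegral (-t) (by ring)
  simp only [neg_mul] at hintneg
  rw [hintneg] at hB
  have hBM := volume_mul_volume_le_sq_of_midpoint_mem
    (hK.measurableSet_normalGraphBody hinj hκ hcont fun x hx =>
      (abs_lt.1 ((hψt x hx).trans_lt htκ)).1)
    (hK.measurableSet_normalGraphBody hinj hκ hcont.neg fun x hx =>
      neg_lt_neg (abs_lt.1 ((hψt x hx).trans_lt htκ)).2) hWmeas (hmid t ht htt₀)
  have hQI : 0 ≤ ∫ x, Q x ∂(μHE[k] : Measure (frontier K)) := integral_nonneg hQ0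
  rw [integral_const_mul] at hW
  have hfin := (mul_le_mul' hA hB).trans (hBM.trans (pow_le_pow_left' hW 2))
  rw [← sq, ← ENNReal.ofReal_pow (by positivity), ← ENNReal.ofReal_pow (by positivity),
    ENNReal.ofReal_le_ofReal_iff (by positivity)] at hfin
  have hle := le_of_sq_le_sq hfin (by positivity)
  have ht2 : 0 < t ^ 2 := by positivity
  refine le_of_mul_le_mul_left (a := t ^ 2) ?_ ht2
  linarith

theorem mul_integral_sq_le (hk0 : k ≠ 0) (hψ : ContDiff ℝ 1 ψ)
    (hmean : ∫ x : frontier K, ψ x ∂(μHE[k] : Measure (frontier K)) = 0) :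
    k * β ^ 2 * ∫ x : frontier K, ψ x ^ 2 ∂(μHE[k] : Measure (frontier K)) ≤
      ∫ x : frontier K, ‖gradient ψ x - ⟪ν x, gradient ψ x⟫ • ν x‖ ^ 2
        ∂(μHE[k] : Measure (frontier K)) := by
  have hcomp : CompactSpace (frontier K) :=
    isCompact_iff_compactSpace.1 hK.isCompact.isCompact_frontier
  have hβ := hK.β_pos
  have hg := hK.continuous_tangential_gradient hψ
  set m : Measure (frontier K) := μHE[k]
  set g : frontier K → ℝ := fun x => ‖gradient ψ x - ⟪ν x, gradient ψ x⟫ • ν x‖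
  have hg' : Continuous g := hg.norm
  have key : ∀ s ∈ Set.Ioo (0 : ℝ) 1, k * β ^ 2 * (1 - s) ^ 2 * ∫ x : frontier K, ψ x ^ 2 ∂m ≤
      (1 + s) * (∫ x, g x ^ 2 ∂m + s * (4 * ∫ x, g x ∂m) + s ^ 2 * (4 * m.real Set.univ)) := by
    rintro s ⟨hs0, hs1⟩
    have hs' : 0 < 1 - s := by linarith
    have h := hK.mul_integral_sq_le_of_lt hk0 hψ hmean (a := 1 + s.toNNReal)
      (lt_add_of_pos_right _ (Real.toNNReal_pos.2 hs0)) (b := β * (1 - s)) (by positivity)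
      (by nlinarith) hs0 hs1
    rw [integral_div] at h
    have hexp : ∫ x, (g x + 2 * s) ^ 2 ∂m =
        ∫ x, g x ^ 2 ∂m + s * (4 * ∫ x, g x ∂m) + s ^ 2 * (4 * m.real Set.univ) := by
      have : ∀ x, (g x + 2 * s) ^ 2 = g x ^ 2 + 4 * s * g x + 4 * s ^ 2 := fun x => by ring
      simp only [this]
      rw [integral_add (integrable_of_continuous (by fun_prop)) (integrable_const _),
        integral_add (integrable_of_continuous (by fun_prop))
          (integrable_of_continuous (by fun_prop)), integral_const_mul, integral_const]
      simp only [smul_eq_mul]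
      ring
    rw [hexp, ← mul_div_assoc, le_div_iff₀ (by positivity)] at h
    push_cast at h
    rw [Real.coe_toNNReal _ hs0.le] at h
    linarith
  have hl : Tendsto (fun s : ℝ => k * β ^ 2 * (1 - s) ^ 2 * ∫ x : frontier K, ψ x ^ 2 ∂m)
      (𝓝[>] 0) (𝓝 (k * β ^ 2 * (1 - 0) ^ 2 * ∫ x : frontier K, ψ x ^ 2 ∂m)) :=
    ((by fun_prop : Continuous fun s : ℝ =>
      k * β ^ 2 * (1 - s) ^ 2 * ∫ x : frontier K, ψ x ^ 2 ∂m).tendsto 0).mono_left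
        nhdsWithin_le_nhds
  have hr : Tendsto (fun s : ℝ => (1 + s) *
      (∫ x, g x ^ 2 ∂m + s * (4 * ∫ x, g x ∂m) + s ^ 2 * (4 * m.real Set.univ))) (𝓝[>] 0)
      (𝓝 ((1 + 0) *
        (∫ x, g x ^ 2 ∂m + 0 * (4 * ∫ x, g x ∂m) + 0 ^ 2 * (4 * m.real Set.univ)))) :=
    ((by fun_prop : Continuous fun s : ℝ => (1 + s) *
      (∫ x, g x ^ 2 ∂m + s * (4 * ∫ x, g x ∂m) + s ^ 2 * (4 * m.real Set.univ))).tendsto 0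
        ).mono_left nhdsWithin_le_nhds
  have hlim := le_of_tendsto_of_tendsto hl hr
    (Filter.mem_of_superset (Ioo_mem_nhdsGT one_pos) key)
  rwa [sub_zero, one_pow, mul_one, add_zero, one_mul, zero_mul, add_zero, zero_pow two_ne_zero,
    zero_mul, add_zero] at hlim

end IsUniformlyConvexBody

end Poincare

theorem exists_setIntegral_hausdorffMeasure_eq {X : Type*} [MetricSpace X] [MeasurableSpace X]
    [BorelSpace X] {S : Set X} (hS : MeasurableSet S) (k : ℕ) :
    ∃ c : ℝ, 0 < c ∧ ∀ f : X → ℝ, ∫ x : S, f x ∂(μHE[k] : Measure S) =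
      c * ∫ x in S, f x ∂μH[(k : ℝ)] := by
  refine ⟨_, NNReal.coe_pos.2 (pos_iff_ne_zero.2
    (Measure.addHaarScalarFactor_volume_hausdorffMeasure_ne_zero k)), fun f => ?_⟩
  have h := (MeasurableEmbedding.subtype_coe hS).integral_map (μ := (μHE[k] : Measure S)) f
  rw [isometry_subtype_coe.map_euclideanHausdorffMeasure, Subtype.range_coe,
    Measure.euclideanHausdorffMeasure_def, Measure.restrict_smul, integral_smul_nnreal_measure,
    NNReal.smul_def, smul_eq_mul] at h
  exact h.symm

theorem exists_integral_sub_average_sq_ne_zero {n : ℕ} {S : Set (EuclideanSpace ℝ (Fin n))}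
    (hS : IsCompact S) (m : Measure S) [IsFiniteMeasure m] [NullSingletonClass m] (hm : m ≠ 0) :
    ∃ i, ∫ x : S, (x.1 i - ⨍ y : S, y.1 i ∂m) ^ 2 ∂m ≠ 0 := by
  have hcomp : CompactSpace S := isCompact_iff_compactSpace.1 hS
  by_contra! h
  have hae : ∀ᵐ x ∂m, ∀ i, x.1 i = ⨍ y : S, y.1 i ∂m := by
    refine ae_all_iff.2 fun i => ?_
    have := (integral_eq_zero_iff_of_nonneg (fun x => sq_nonneg _)
      (integrable_of_continuous
        (((by fun_prop : Continuous fun x : S => x.1 i).sub continuous_const).pow 2))).1 (h i)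
    filter_upwards [this] with x hx
    exact sub_eq_zero.1 (pow_eq_zero_iff two_ne_zero |>.1 hx)
  have hsub : {x : S | ∀ i, x.1 i = ⨍ y : S, y.1 i ∂m}.Subsingleton := fun x hx y hy =>
    Subtype.ext (PiLp.ext fun i => (hx i).trans (hy i).symm)
  refine hm (Measure.measure_univ_eq_zero.1 (measure_mono_null (fun x _ => ?_)
    (measure_union_null hae (hsub.measure_zero m))))
  exact (em (∀ i, x.1 i = ⨍ y : S, y.1 i ∂m)).symm

/-- Lichnerowicz-type lower bound for the first nonzero eigenvalue of the
Laplace–Beltrami operator on the boundary of a convex body:  Let `K ⊂ ℝⁿ` be a convex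
body of class `C²₊` (compact convex set with nonempty interior, whose outer unit normal
field `ν` is `C¹` near `∂K`) and let `α > 0` be such that all principal curvatures of
`∂K` are `≥ α` at every point.  Then the first nonzero eigenvalue `λ(∂K)` of the
Laplace–Beltrami operator on `∂K`, given by its variational (Rayleigh quotient)
characterization
`λ(∂K) = inf { ∫_{∂K} |∇ψ|² dℋ^{n-1} / ∫_{∂K} ψ² dℋ^{n-1} :
  ψ ∈ C¹(∂K), ψ ≢ 0, ∫_{∂K} ψ dℋ^{n-1} = 0 }`,
satisfies `λ(∂K) ≥ (n-1) α²`.  Here `ψ` ranges over `C¹` extensions and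
`∇ψ x = tproj (ν x) (gradient ψ x)` is the tangential gradient on `∂K`. -/
theorem convex_body_first_eigenvalue_lower_bound
    {n : ℕ} (hn : 2 ≤ n) (K : Set (E n))
    (hKconv : Convex ℝ K) (hKcomp : IsCompact K) (hKint : (interior K).Nonempty)
    (ν : E n → E n) (U : Set (E n)) (hU : IsOpen U) (hKU : frontier K ⊆ U)
    (hνC1 : ContDiffOn ℝ 1 ν U)
    (hνunit : ∀ x ∈ frontier K, ‖ν x‖ = 1)
    (hνouter : ∀ x ∈ frontier K, ∀ y ∈ K, ⟪y - x, ν x⟫ ≤ 0)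
    (α : ℝ) (hα : 0 < α)
    (hcurv : ∀ x ∈ frontier K, ∀ v ∈ (ℝ ∙ (ν x))ᗮ,
      α * ‖v‖ ^ 2 ≤ ⟪fderiv ℝ ν x v, v⟫) :
    ((n : ℝ) - 1) * α ^ 2 ≤
      sInf { r : ℝ | ∃ ψ : E n → ℝ, ContDiff ℝ 1 ψ ∧
        (∫ x in frontier K, ψ x ∂μH[(n : ℝ) - 1]) = 0 ∧
        (∫ x in frontier K, (ψ x) ^ 2 ∂μH[(n : ℝ) - 1]) ≠ 0 ∧
        r = (∫ x in frontier K, ‖tproj (ν x) (gradient ψ x)‖ ^ 2 ∂μH[(n : ℝ) - 1]) /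
            (∫ x in frontier K, (ψ x) ^ 2 ∂μH[(n : ℝ) - 1]) } := by
  obtain ⟨k, rfl⟩ : ∃ k, n = k + 1 := ⟨n - 1, by omega⟩
  have hk0 : k ≠ 0 := by omega
  have hrank : Module.finrank ℝ (EuclideanSpace ℝ (Fin (k + 1))) = k + 1 := by simp
  obtain ⟨L, hK⟩ := IsSmoothConvexBody.of_contDiffOn hKconv hKcomp hKint hU hKU hνC1 hνunit hνouter
  have hfin := hK.isFiniteMeasure_boundary hrank
  have hcomp : CompactSpace (frontier K) := isCompact_iff_compactSpace.1 hKcomp.isCompact_frontier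
  have hbody : ∀ β, 0 < β → β < α → ∃ δ, IsUniformlyConvexBody K ν L β δ := fun β hβ hβα => by
    obtain ⟨δ, hδ, h⟩ := exists_half_mul_sq_le_inner hK hU hKU hνC1 hcurv hβ hβα
    exact ⟨δ, hK, hβ, hδ, h⟩
  obtain ⟨c, hc, hintegral⟩ := exists_setIntegral_hausdorffMeasure_eq
    (isClosed_frontier (s := K)).measurableSet k
  rw [show ((k + 1 : ℕ) : ℝ) - 1 = k by push_cast; ring]
  refine le_csInf ?_ ?_
  · obtain ⟨δ, hKβ⟩ := hbody (α / 2) (by positivity) (by linarith)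
    obtain ⟨κ, hκ, hinj⟩ := hKβ.exists_injOn_tubeMap
    have hm := hKβ.boundary_measure_ne_zero hrank hinj hκ
    have hnull : NullSingletonClass (μHE[k] : Measure (frontier K)) := by
      have := Measure.nullSingletonClass_hausdorff (frontier K) (d := k) (by positivity)
      refine ⟨fun x => ?_⟩
      rw [Measure.euclideanHausdorffMeasure_def, Measure.smul_apply, measure_singleton, smul_zero]
    obtain ⟨i, hi⟩ := exists_integral_sub_average_sq_ne_zero hKcomp.isCompact_frontier _ hm
    refine ⟨_, fun x => x i - ⨍ y : frontier K, y.1 i ∂(μHE[k] : Measure (frontier K)),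
      by fun_prop, ?_, fun h => hi ?_, rfl⟩
    · refine (mul_eq_zero.1 ((hintegral _).symm.trans ?_)).resolve_left hc.ne'
      have : NeZero (μHE[k] : Measure (frontier K)) := ⟨hm⟩
      exact integral_sub_average _ _
    · exact (hintegral fun x => (x i - ⨍ y : frontier K, y.1 i ∂μHE[k]) ^ 2).trans
        (by rw [h, mul_zero])
  · rintro r ⟨ψ, hψ, hmean, hne, rfl⟩
    have hpos := lt_of_le_of_ne (integral_nonneg fun x => sq_nonneg (ψ x)) hne.symm
    rw [le_div_iff₀ hpos]
    have key : ∀ β ∈ Set.Ioo 0 α, k * β ^ 2 * ∫ x in frontier K, ψ x ^ 2 ∂μH[(k : ℝ)] ≤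
        ∫ x in frontier K, ‖tproj (ν x) (gradient ψ x)‖ ^ 2 ∂μH[(k : ℝ)] := by
      rintro β ⟨hβ, hβα⟩
      obtain ⟨δ, hKβ⟩ := hbody β hβ hβα
      have h := hKβ.mul_integral_sq_le hk0 hψ (by rw [hintegral ψ, hmean, mul_zero])
      have ht : ∀ x, gradient ψ x - ⟪ν x, gradient ψ x⟫ • ν x = tproj (ν x) (gradient ψ x) :=
        fun x => rfl
      simp only [ht] at h
      rw [hintegral fun x => ψ x ^ 2, hintegral fun x => ‖tproj (ν x) (gradient ψ x)‖ ^ 2,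
        mul_left_comm] at h
      exact le_of_mul_le_mul_left h hc
    have hlim : Filter.Tendsto
        (fun β : ℝ => k * β ^ 2 * ∫ x in frontier K, ψ x ^ 2 ∂μH[(k : ℝ)])
        (nhdsWithin α (Set.Iio α))
        (nhds (k * α ^ 2 * ∫ x in frontier K, ψ x ^ 2 ∂μH[(k : ℝ)])) :=
      ((by fun_prop : Continuous fun β : ℝ =>
        k * β ^ 2 * ∫ x in frontier K, ψ x ^ 2 ∂μH[(k : ℝ)]).tendsto α).mono_left
          nhdsWithin_le_nhds
    exact le_of_tendsto hlim (Filter.mem_of_superset (Ioo_mem_nhdsLT hα) key)
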